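/- Fix d ≥ 2. Let x be the unique root in (0,1) of (d+1)(1−x) + (1+dx)·log x = 0 and set c_d* = −log x / (1−x)^d. If p ≥ c/n for a constant c > c_d*, then w.h.p. H_d(Y_d(n,p), ℝ) ≠ 0. -/

import Mathlib

open MeasureTheory Filter Finset Matrix

noncomputable section

/-- Bernoulli measure on `Bool` with success probability `p` (clamped to `[0,1]`). -/
def bernoulliBool (p : ℝ) : Measure Bool :=
  ENNReal.ofReal (max 0 (min p 1)) • Measure.dirac true +
    ENNReal.ofReal (1 - max 0 (min p 1)) • Measure.dirac false

instance (p : ℝ) : IsFiniteMeasure (bernoulliBool p) := by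
  constructor
  simp only [bernoulliBool, Measure.add_apply, Measure.smul_apply, smul_eq_mul,
    measure_univ, mul_one]
  exact ENNReal.add_lt_top.mpr ⟨ENNReal.ofReal_lt_top, ENNReal.ofReal_lt_top⟩

/-- Index type for potential `d`-dimensional faces on vertex set `Fin n`:
the `(d+1)`-element subsets. -/
abbrev FaceIdx (n d : ℕ) : Type := {s : Finset (Fin n) // s.card = d + 1}

/-- The distribution of the random `d`-complex `Y_d(n,p)`: each potential `d`-face
gets an independent Bernoulli(`p`) coin. (For `d = 1` this is the Erdős–Rényi model
`G(n,p)`.) -/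
def YMeasure (n d : ℕ) (p : ℝ) : Measure (FaceIdx n d → Bool) :=
  Measure.pi fun _ => bernoulliBool p

/-- The random `d`-complex: all faces of dimension `≤ d - 1` (i.e. all subsets of
cardinality `≤ d`, including `∅`, so that degree-0 homology below is reduced
homology), together with the chosen `d`-faces. -/
def Ycomplex (n d : ℕ) (ω : FaceIdx n d → Bool) : Finset (Finset (Fin n)) :=
  Finset.univ.filter fun s => s.card ≤ d ∨ ∃ h : s.card = d + 1, ω ⟨s, h⟩ = true

/-- The Erdős–Rényi random graph associated to a configuration of edge coins. -/
def graphOf (n : ℕ) (ω : FaceIdx n 1 → Bool) : SimpleGraph (Fin n) where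
  Adj i j := i ≠ j ∧ ∃ e : FaceIdx n 1, ω e = true ∧ i ∈ e.1 ∧ j ∈ e.1
  symm := ⟨fun i j ⟨hne, e, he, hi, hj⟩ => ⟨hne.symm, e, he, hj, hi⟩⟩
  loopless := ⟨fun i ⟨hne, _⟩ => hne rfl⟩

instance (n : ℕ) (ω : FaceIdx n 1 → Bool) : DecidableRel (graphOf n ω).Adj :=
  fun i j =>
    inferInstanceAs (Decidable (i ≠ j ∧ ∃ e : FaceIdx n 1, ω e = true ∧ i ∈ e.1 ∧ j ∈ e.1))

/-- The clique complex of the graph determined by the edge coins `ω`: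
faces are vertex sets of complete subgraphs (including `∅` and singletons). -/
def cliqueComplex (n : ℕ) (ω : FaceIdx n 1 → Bool) : Finset (Finset (Fin n)) :=
  Finset.univ.filter fun s => ∀ i ∈ s, ∀ j ∈ s, i ≠ j → (graphOf n ω).Adj i j

/-- The group of simplicial `G`-chains of a complex `K`, in cardinality `c`
(i.e. dimension `c - 1`): functions on the faces of `K` of cardinality `c`. -/
abbrev Chains {V : Type} [Fintype V] [DecidableEq V]
    (K : Finset (Finset V)) (c : ℕ) (G : Type) : Type :=
  {s : Finset V // s ∈ K ∧ s.card = c} → G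

/-- The simplicial boundary map, from chains of cardinality `c+1` to chains of
cardinality `c`, with the usual alternating signs coming from the linear order
on the vertices. -/
def chainBoundary {V : Type} [Fintype V] [DecidableEq V] [LinearOrder V]
    (K : Finset (Finset V)) (c : ℕ) {G : Type} [AddCommGroup G]
    (f : Chains K (c + 1) G) : Chains K c G :=
  fun τ => ∑ v : V,
    if h : v ∉ τ.1 ∧ insert v τ.1 ∈ K then
      ((-1 : ℤ) ^ (τ.1.filter (fun u => u < v)).card) •
        f ⟨insert v τ.1, h.2, by rw [Finset.card_insert_of_notMem h.1, τ.2.2]⟩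
    else 0

/-- Vanishing of the simplicial homology of `K` with coefficients in `G` in
degree `i` (faces of cardinality `i+1`): every cycle is a boundary.
If `∅ ∈ K` this is reduced homology (the boundary map to cardinality-0 chains
is the augmentation); in degrees `i ≥ 1` reduced and unreduced homology agree. -/
def HomologyZero {V : Type} [Fintype V] [DecidableEq V] [LinearOrder V]
    (K : Finset (Finset V)) (i : ℕ) (G : Type) [AddCommGroup G] : Prop :=
  ∀ f : Chains K (i + 1) G, chainBoundary K i f = 0 →
    ∃ g : Chains K (i + 2) G, chainBoundary K (i + 1) g = f

/-- Vanishing of top-dimensional homology `H_d(K,G)`, i.e. the kernel of the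
`d`-th boundary map is zero. -/
def TopHomologyZero {V : Type} [Fintype V] [DecidableEq V] [LinearOrder V]
    (K : Finset (Finset V)) (d : ℕ) (G : Type) [AddCommGroup G] : Prop :=
  ∀ f : Chains K (d + 1) G, chainBoundary K d f = 0 → f = 0

/-- The boundary map on real coefficients, as a linear map. -/
def chainBoundaryLin {V : Type} [Fintype V] [DecidableEq V] [LinearOrder V]
    (K : Finset (Finset V)) (c : ℕ) : Chains K (c + 1) ℝ →ₗ[ℝ] Chains K c ℝ where
  toFun := chainBoundary K c
  map_add' f g := by
    funext τ
    simp only [chainBoundary, Pi.add_apply]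
    rw [← Finset.sum_add_distrib]
    refine Finset.sum_congr rfl fun v _ => ?_
    split
    · simp [smul_add]
    · simp
  map_smul' r f := by
    funext τ
    simp only [chainBoundary, Pi.smul_apply, RingHom.id_apply]
    rw [Finset.smul_sum]
    refine Finset.sum_congr rfl fun v _ => ?_
    split
    · exact smul_comm _ _ _
    · simp

/-- The `k`-th Betti number of `K`: the dimension of the `k`-th real simplicial
homology, i.e. of (kernel of `∂_k`) / (image of `∂_{k+1}`). -/
def bettiNumber {V : Type} [Fintype V] [DecidableEq V] [LinearOrder V]
    (K : Finset (Finset V)) (k : ℕ) : ℕ :=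
  Module.finrank ℝ
    (↥(LinearMap.ker (chainBoundaryLin K k)) ⧸
      (LinearMap.range (chainBoundaryLin K (k + 1))).comap
        (LinearMap.ker (chainBoundaryLin K k)).subtype)

/-- The link of a face `σ` in the complex `K`. -/
def linkSet {V : Type} [Fintype V] [DecidableEq V]
    (K : Finset (Finset V)) (σ : Finset V) : Finset (Finset V) :=
  Finset.univ.filter fun τ => τ ∩ σ = ∅ ∧ τ ∪ σ ∈ K

/-- The graph underlying the link of a face `σ`: its vertices are the vertices
of the link, joined when they span an edge of the link. -/
def linkGraph {V : Type} [Fintype V] [DecidableEq V]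
    (K : Finset (Finset V)) (σ : Finset V) :
    SimpleGraph {v : V // {v} ∈ linkSet K σ} where
  Adj a b := a ≠ b ∧ ({a.1, b.1} : Finset V) ∈ linkSet K σ
  symm := ⟨fun a b ⟨hab, h⟩ => ⟨hab.symm, by rwa [Finset.pair_comm]⟩⟩
  loopless := ⟨fun a ⟨hab, _⟩ => hab rfl⟩

instance {V : Type} [Fintype V] [DecidableEq V] (K : Finset (Finset V)) (σ : Finset V) :
    DecidableRel (linkGraph K σ).Adj :=
  fun a b => inferInstanceAs (Decidable (a ≠ b ∧ ({a.1, b.1} : Finset V) ∈ linkSet K σ))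

/-- The normalized Laplacian `I - D^{-1/2} A D^{-1/2}` of a finite graph. -/
def normalizedLaplacian {W : Type} [Fintype W] [DecidableEq W]
    (H : SimpleGraph W) [DecidableRel H.Adj] : Matrix W W ℝ :=
  Matrix.of fun a b =>
    (if a = b then (1 : ℝ) else 0) -
      (if H.Adj a b then 1 / Real.sqrt ((H.degree a : ℝ) * (H.degree b : ℝ)) else 0)

/-- An elementary `d`-collapse step: remove a free `(d-1)`-face `σ` together with
the unique `d`-face `τ` containing it. -/
def CollapseStep {V : Type} [DecidableEq V] (d : ℕ) (K K' : Finset (Finset V)) : Prop :=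
  ∃ σ τ : Finset V, σ ∈ K ∧ τ ∈ K ∧ τ.card = d + 1 ∧ σ ⊆ τ ∧ σ.card = d ∧
    (∀ ρ ∈ K, σ ⊆ ρ → ρ.card = d + 1 → ρ = τ) ∧ K' = K \ {σ, τ}

/-- `K` is `d`-collapsible if some finite sequence of elementary collapses reduces it
to a complex of dimension at most `d-1`. -/
def IsDCollapsible {V : Type} [DecidableEq V] (d : ℕ) (K : Finset (Finset V)) : Prop :=
  ∃ K' : Finset (Finset V),
    Relation.ReflTransGen (CollapseStep d) K K' ∧ ∀ s ∈ K', s.card ≤ d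

/-- The geometric realization of a complex on vertex set `Fin n`, inside `ℝ^n`:
the union over the faces of the convex hulls of the corresponding standard
basis vectors. -/
def geomReal (n : ℕ) (K : Finset (Finset (Fin n))) : Set (Fin n → ℝ) :=
  ⋃ σ ∈ K, convexHull ℝ ((fun i => (Pi.single i 1 : Fin n → ℝ)) '' ↑σ)

/-- The boundary of the simplex on the vertex set `τ`, as a chain of cardinality
`c` (to be used with `τ.card = c + 1`): the alternating sum of the `c`-element
subsets of `τ`. -/
def simplexBoundaryChain {V : Type} [Fintype V] [DecidableEq V] [LinearOrder V]
    (K : Finset (Finset V)) (c : ℕ) (τ : Finset V) : Chains K c ℝ :=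
  fun σ => ∑ v ∈ τ,
    if σ.1 = τ.erase v then ((-1 : ℝ) ^ (τ.filter (fun u => u < v)).card) else 0

/-- Index type for the multiparameter model: all potential faces of dimension `≥ 1`. -/
abbrev MultiIdx (n : ℕ) : Type := {s : Finset (Fin n) // 2 ≤ s.card}

/-- The distribution of the multiparameter random complex `X(n; p₁, p₂, …)`:
a potential face of cardinality `i+1` gets an independent Bernoulli(`p i`) coin. -/
def multiMeasure (n : ℕ) (p : ℕ → ℝ) : Measure (MultiIdx n → Bool) :=
  Measure.pi fun t => bernoulliBool (p (t.1.card - 1))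

/-- The multiparameter random complex: a set `s` is a face iff every subset of `s`
of dimension `≥ 1` has its coin turned on (this is exactly the
inductive-by-dimension construction: a face is present iff its coin is on and all
of its boundary faces are present). -/
def multiComplex (n : ℕ) (ω : MultiIdx n → Bool) : Finset (Finset (Fin n)) :=
  Finset.univ.filter fun s => ∀ t : MultiIdx n, t.1 ⊆ s → ω t = true

/-- The Vietoris–Rips complex of the points `pts` at scale `r`. -/
def VRcomplex (n d : ℕ) (pts : Fin n → EuclideanSpace ℝ (Fin d)) (r : ℝ) :
    Finset (Finset (Fin n)) :=
  Finset.univ.filter fun s => ∀ i ∈ s, ∀ j ∈ s, dist (pts i) (pts j) ≤ r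

end


namespace AL
noncomputable section

variable {ι : Type*} [DecidableEq ι]

def ind (P : Prop) : ℝ := @ite ℝ P (Classical.propDecidable P) 1 0

lemma ind_true {P : Prop} (h : P) : ind P = 1 := by simp [ind, h]
lemma ind_false {P : Prop} (h : ¬ P) : ind P = 0 := by simp [ind, h]
lemma ind_nonneg (P : Prop) : 0 ≤ ind P := by
  by_cases h : P
  · rw [ind_true h]; norm_num
  · rw [ind_false h]
lemma ind_le_one (P : Prop) : ind P ≤ 1 := by
  by_cases h : P
  · rw [ind_true h]
  · rw [ind_false h]; norm_num
lemma ind_mono {P Q : Prop} (h : P → Q) : ind P ≤ ind Q := by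
  by_cases hP : P
  · rw [ind_true hP, ind_true (h hP)]
  · rw [ind_false hP]; exact ind_nonneg Q
lemma ind_not (P : Prop) : ind (¬ P) = 1 - ind P := by
  by_cases h : P
  · rw [ind_true h, ind_false (not_not.mpr h)]; norm_num
  · rw [ind_false h, ind_true h]; norm_num

/-- expectation over a random subset of `S`, each element kept with probability `p` -/
def Ex (p : ℝ) (S : Finset ι) (f : Finset ι → ℝ) : ℝ :=
  ∑ Y ∈ S.powerset, p ^ (#Y) * (1 - p) ^ (#(S \ Y)) * f Y

lemma Ex_empty (p : ℝ) (f : Finset ι → ℝ) : Ex p ∅ f = f ∅ := by simp [Ex]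

lemma Ex_insert (p : ℝ) {a : ι} {S : Finset ι} (ha : a ∉ S) (f : Finset ι → ℝ) :
    Ex p (insert a S) f = (1 - p) * Ex p S f + p * Ex p S (fun Y => f (insert a Y)) := by
  unfold Ex
  rw [Finset.sum_powerset_insert ha, Finset.mul_sum, Finset.mul_sum]
  congr 1
  · refine Finset.sum_congr rfl fun Y hY => ?_
    have hY' : Y ⊆ S := Finset.mem_powerset.mp hY
    have haY : a ∉ Y := fun h => ha (hY' h)
    rw [Finset.insert_sdiff_of_notMem _ haY, Finset.card_insert_of_notMem (by simp [ha]), pow_succ]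
    ring
  · refine Finset.sum_congr rfl fun Y hY => ?_
    have hY' : Y ⊆ S := Finset.mem_powerset.mp hY
    have haY : a ∉ Y := fun h => ha (hY' h)
    rw [Finset.card_insert_of_notMem haY, pow_succ]
    have : insert a S \ insert a Y = S \ Y := by
      ext b; simp only [Finset.mem_sdiff, Finset.mem_insert]; constructor
      · rintro ⟨h1 | h1, h2⟩
        · exact absurd (Or.inl h1) h2
        · exact ⟨h1, fun h => h2 (Or.inr h)⟩
      · rintro ⟨h1, h2⟩
        exact ⟨Or.inr h1, by rintro (rfl | h); exact ha h1; exact h2 h⟩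
    rw [this]; ring

lemma Ex_mono {p : ℝ} (h0 : 0 ≤ p) (h1 : p ≤ 1) (S : Finset ι) {f g : Finset ι → ℝ}
    (h : ∀ Y ⊆ S, f Y ≤ g Y) : Ex p S f ≤ Ex p S g := by
  unfold Ex
  refine Finset.sum_le_sum fun Y hY => ?_
  have : 0 ≤ 1 - p := by linarith
  exact mul_le_mul_of_nonneg_left (h Y (Finset.mem_powerset.mp hY)) (by positivity)

lemma Ex_congr {p : ℝ} (S : Finset ι) {f g : Finset ι → ℝ}
    (h : ∀ Y ⊆ S, f Y = g Y) : Ex p S f = Ex p S g := by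
  unfold Ex
  refine Finset.sum_congr rfl fun Y hY => ?_
  rw [h Y (Finset.mem_powerset.mp hY)]

lemma Ex_add (p : ℝ) (S : Finset ι) (f g : Finset ι → ℝ) :
    Ex p S (fun Y => f Y + g Y) = Ex p S f + Ex p S g := by
  unfold Ex; rw [← Finset.sum_add_distrib]
  exact Finset.sum_congr rfl fun Y _ => by ring

lemma Ex_sub (p : ℝ) (S : Finset ι) (f g : Finset ι → ℝ) :
    Ex p S (fun Y => f Y - g Y) = Ex p S f - Ex p S g := by
  unfold Ex; rw [← Finset.sum_sub_distrib]
  exact Finset.sum_congr rfl fun Y _ => by ring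

lemma Ex_mul_left (p : ℝ) (S : Finset ι) (r : ℝ) (f : Finset ι → ℝ) :
    Ex p S (fun Y => r * f Y) = r * Ex p S f := by
  unfold Ex; rw [Finset.mul_sum]
  exact Finset.sum_congr rfl fun Y _ => by ring

lemma Ex_sum (p : ℝ) (S : Finset ι) {κ : Type*} (T : Finset κ) (f : κ → Finset ι → ℝ) :
    Ex p S (fun Y => ∑ k ∈ T, f k Y) = ∑ k ∈ T, Ex p S (f k) := by
  unfold Ex; rw [Finset.sum_comm]
  exact Finset.sum_congr rfl fun Y _ => by rw [Finset.mul_sum]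

lemma Ex_const (p : ℝ) (S : Finset ι) (r : ℝ) : Ex p S (fun _ => r) = r := by
  induction S using Finset.induction_on with
  | empty => rw [Ex_empty]
  | insert a S ha ih => rw [Ex_insert p ha, ih]; ring

lemma Ex_card (p : ℝ) (S : Finset ι) : Ex p S (fun Y => (#Y : ℝ)) = #S * p := by
  induction S using Finset.induction_on with
  | empty => rw [Ex_empty]; simp
  | insert a S ha ih =>
    rw [Ex_insert p ha, ih]
    have : Ex p S (fun Y => (#(insert a Y) : ℝ)) = Ex p S (fun Y => (#Y : ℝ) + 1) := by
      refine Ex_congr S fun Y hY => ?_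
      rw [Finset.card_insert_of_notMem (fun h => ha (hY h))]; push_cast; ring
    rw [this, Ex_add, ih, Ex_const, Finset.card_insert_of_notMem ha]; push_cast; ring

lemma Ex_map {κ : Type*} [DecidableEq κ] (e : κ ↪ ι) (p : ℝ) (S : Finset κ) (f : Finset ι → ℝ) :
    Ex p (S.map e) f = Ex p S (fun Y => f (Y.map e)) := by
  induction S using Finset.induction_on generalizing f with
  | empty => simp [Ex_empty]
  | insert a S ha ih =>
    rw [Finset.map_insert, Ex_insert p (by simpa using ha), Ex_insert p ha, ih, ih]
    simp only [Finset.map_insert]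

/-- Harris inequality for antitone functions -/
lemma harris {p : ℝ} (h0 : 0 ≤ p) (h1 : p ≤ 1) (S : Finset ι) (f g : Finset ι → ℝ)
    (hf : Antitone f) (hg : Antitone g) :
    Ex p S f * Ex p S g ≤ Ex p S (fun Y => f Y * g Y) := by
  induction S using Finset.induction_on generalizing f g with
  | empty => simp [Ex_empty]
  | insert a S ha ih =>
    rw [Ex_insert p ha, Ex_insert p ha, Ex_insert p ha]
    have i1 := ih f g hf hg
    have i2 := ih (fun Y => f (insert a Y)) (fun Y => g (insert a Y))
      (fun _ _ h => hf (Finset.insert_subset_insert a h))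
      (fun _ _ h => hg (Finset.insert_subset_insert a h))
    have j1 : Ex p S (fun Y => f (insert a Y)) ≤ Ex p S f :=
      Ex_mono h0 h1 S fun Y _ => hf (Finset.subset_insert a Y)
    have j2 : Ex p S (fun Y => g (insert a Y)) ≤ Ex p S g :=
      Ex_mono h0 h1 S fun Y _ => hg (Finset.subset_insert a Y)
    set A := Ex p S f
    set B := Ex p S g
    set A' := Ex p S (fun Y => f (insert a Y))
    set B' := Ex p S (fun Y => g (insert a Y))
    have k1 := mul_le_mul_of_nonneg_left i1 (by linarith : 0 ≤ 1 - p)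
    have k2 := mul_le_mul_of_nonneg_left i2 h0
    have k3 : 0 ≤ p * (1 - p) * ((A - A') * (B - B')) :=
      mul_nonneg (mul_nonneg h0 (by linarith)) (mul_nonneg (by linarith) (by linarith))
    nlinarith

lemma harris_prod {p : ℝ} (h0 : 0 ≤ p) (h1 : p ≤ 1) (S : Finset ι) {κ : Type*} [DecidableEq κ]
    (T : Finset κ)
    (f : κ → Finset ι → ℝ) (hf : ∀ k, Antitone (f k)) (hn : ∀ k Y, 0 ≤ f k Y) :
    ∏ k ∈ T, Ex p S (f k) ≤ Ex p S (fun Y => ∏ k ∈ T, f k Y) := by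
  induction T using Finset.induction_on with
  | empty => simp [Ex_const]
  | insert a T ha ih =>
    simp only [Finset.prod_insert ha]
    have hE : 0 ≤ Ex p S (f a) := by
      have := Ex_mono h0 h1 S (f := fun _ => 0) (g := f a) (fun Y _ => hn a Y)
      rwa [Ex_const] at this
    refine (mul_le_mul_of_nonneg_left ih hE).trans (harris h0 h1 S _ _ (hf a) ?_)
    intro Y Z h
    exact Finset.prod_le_prod (fun k _ => hn k _) (fun k _ => hf k h)

/-- variance bound for 1-Lipschitz functions -/
lemma var_le {p : ℝ} (h0 : 0 ≤ p) (h1 : p ≤ 1) (S : Finset ι) (f : Finset ι → ℝ)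
    (hf : ∀ a Y, |f (insert a Y) - f Y| ≤ 1) :
    Ex p S (fun Y => (f Y) ^ 2) - (Ex p S f) ^ 2 ≤ #S * p := by
  induction S using Finset.induction_on generalizing f with
  | empty => simp [Ex_empty]
  | insert a S ha ih =>
    rw [Ex_insert p ha, Ex_insert p ha, Finset.card_insert_of_notMem ha]
    have i1 := ih f hf
    have i2 := ih (fun Y => f (insert a Y)) (fun b Y => by
      rw [Finset.insert_comm]; exact hf b (insert a Y))
    have j1 : Ex p S (fun Y => f (insert a Y)) - Ex p S f ≤ 1 := by
      rw [← Ex_sub]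
      refine (Ex_mono h0 h1 S fun Y _ => (abs_le.mp (hf a Y)).2).trans_eq (Ex_const _ _ _)
    have j2 : -1 ≤ Ex p S (fun Y => f (insert a Y)) - Ex p S f := by
      rw [← Ex_sub]
      exact (Ex_const p S (-1 : ℝ)).symm.le.trans (Ex_mono h0 h1 S fun Y _ => (abs_le.mp (hf a Y)).1)
    set A := Ex p S f
    set A' := Ex p S (fun Y => f (insert a Y))
    have k1 := mul_le_mul_of_nonneg_left i1 (by linarith : 0 ≤ 1 - p)
    have k2 := mul_le_mul_of_nonneg_left i2 h0
    have k3 : (A' - A) ^ 2 ≤ 1 := by nlinarith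
    have k4 : p * (1 - p) * (A' - A) ^ 2 ≤ p * (1 - p) * 1 :=
      mul_le_mul_of_nonneg_left k3 (mul_nonneg h0 (by linarith))
    push_cast
    nlinarith [sq_nonneg p]

/-- monotonicity in `p` -/
lemma Ex_anti_p {p q : ℝ} (h0 : 0 ≤ p) (hpq : p ≤ q) (h1 : q ≤ 1) (S : Finset ι) (f : Finset ι → ℝ)
    (hf : Antitone f) : Ex q S f ≤ Ex p S f := by
  induction S using Finset.induction_on generalizing f with
  | empty => simp [Ex_empty]
  | insert a S ha ih =>
    rw [Ex_insert _ ha, Ex_insert _ ha]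
    have i1 := ih f hf
    have i2 := ih (fun Y => f (insert a Y)) (fun _ _ h => hf (Finset.insert_subset_insert a h))
    have j1 : Ex q S (fun Y => f (insert a Y)) ≤ Ex q S f :=
      Ex_mono (h0.trans hpq) h1 S fun Y _ => hf (Finset.subset_insert a Y)
    nlinarith

/-- concavity in `p` of the expectation of a submodular function -/
lemma Ex_concave {p q : ℝ} (h0 : 0 ≤ p) (hpq : p ≤ q) (h1 : q ≤ 1) (S : Finset ι)
    (f : Finset ι → ℝ)
    (hf : ∀ a, Antitone (fun Y => f (insert a Y) - f (Y.erase a))) :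
    (q - p) * ∑ a ∈ S, Ex q S (fun Y => f (insert a Y) - f (Y.erase a)) ≤ Ex q S f - Ex p S f := by
  induction S using Finset.induction_on generalizing f with
  | empty => simp [Ex_empty]
  | insert a S ha ih =>
    rw [Ex_insert _ ha, Ex_insert _ ha, Finset.sum_insert ha]
    have i1 := ih f hf
    have hanti : ∀ b ∈ S, Antitone (fun Y => f (insert a (insert b Y)) - f (insert a (Y.erase b))) := by
      intro b hb Y Z hYZ
      have hab : a ≠ b := fun h => ha (h ▸ hb)
      have := hf b (Finset.insert_subset_insert a hYZ)
      simp only at this ⊢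
      rw [Finset.erase_insert_of_ne hab, Finset.erase_insert_of_ne hab,
        Finset.insert_comm b a, Finset.insert_comm b a] at this
      exact this
    -- replace f on irrelevant part
    have i2 : (q - p) * ∑ b ∈ S, Ex q S (fun Y => f (insert a (insert b Y)) - f (insert a (Y.erase b)))
        ≤ Ex q S (fun Y => f (insert a Y)) - Ex p S (fun Y => f (insert a Y)) := by
      have := ih (fun Y => f (insert a (Y ∩ S))) ?_
      · have e1 : ∀ r : ℝ, Ex r S (fun Y => f (insert a (Y ∩ S))) = Ex r S (fun Y => f (insert a Y)) :=
          fun r => Ex_congr S fun Y hY => by rw [Finset.inter_eq_left.mpr hY]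
        rw [e1, e1] at this
        refine le_trans (le_of_eq ?_) this
        congr 1
        refine Finset.sum_congr rfl fun b hb => Ex_congr S fun Y hY => ?_
        rw [Finset.inter_eq_left.mpr (Finset.insert_subset hb hY),
          Finset.inter_eq_left.mpr ((Finset.erase_subset b Y).trans hY)]
      · intro b
        by_cases hb : b ∈ S
        · intro Y Z hYZ
          have := hanti b hb (Finset.inter_subset_inter_right hYZ : Y ∩ S ⊆ Z ∩ S)
          simp only at this ⊢
          rw [Finset.insert_inter_of_mem hb, Finset.insert_inter_of_mem hb, Finset.erase_inter,
            Finset.erase_inter]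
          exact this
        · intro Y Z hYZ
          simp only
          have : ∀ X : Finset ι, (insert b X) ∩ S = (X.erase b) ∩ S := by
            intro X
            ext c; simp only [mem_inter, mem_insert, mem_erase]
            constructor
            · rintro ⟨h | h, hc⟩
              · exact absurd (h ▸ hc) hb
              · exact ⟨⟨fun e => hb (e ▸ hc), h⟩, hc⟩
            · rintro ⟨⟨_, h⟩, hc⟩; exact ⟨Or.inr h, hc⟩
          rw [this, this]; simp
    have e3 : Ex q (insert a S) (fun Y => f (insert a Y) - f (Y.erase a)) =
        Ex q S (fun Y => f (insert a Y)) - Ex q S f := by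
      rw [Ex_insert _ ha, ← Ex_sub]
      have : ∀ Y ⊆ S, f (insert a (insert a Y)) - f ((insert a Y).erase a) = f (insert a Y) - f Y :=
        fun Y hY => by rw [Finset.insert_idem, Finset.erase_insert (fun h => ha (hY h))]
      rw [Ex_congr S this]
      have : ∀ Y ⊆ S, f (insert a Y) - f (Y.erase a) = f (insert a Y) - f Y :=
        fun Y hY => by rw [Finset.erase_eq_of_notMem (fun h => ha (hY h))]
      rw [Ex_congr S this]; ring
    rw [e3]
    have e4 : ∀ b ∈ S, Ex q (insert a S) (fun Y => f (insert b Y) - f (Y.erase b)) =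
        (1 - q) * Ex q S (fun Y => f (insert b Y) - f (Y.erase b)) +
        q * Ex q S (fun Y => f (insert a (insert b Y)) - f (insert a (Y.erase b))) := by
      intro b hb
      rw [Ex_insert _ ha]
      have hab : a ≠ b := fun h => ha (h ▸ hb)
      congr 2
      refine Ex_congr S fun Y _ => ?_
      rw [Finset.erase_insert_of_ne hab, Finset.insert_comm b a]
    rw [Finset.sum_congr rfl e4, Finset.sum_add_distrib, ← Finset.mul_sum, ← Finset.mul_sum]
    have j : ∑ b ∈ S, Ex q S (fun Y => f (insert a (insert b Y)) - f (insert a (Y.erase b))) ≤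
        ∑ b ∈ S, Ex q S (fun Y => f (insert b Y) - f (Y.erase b)) := by
      refine Finset.sum_le_sum fun b hb => Ex_mono (h0.trans hpq) h1 S fun Y hY => ?_
      have hab : a ≠ b := fun h => ha (h ▸ hb)
      have := hf b (Finset.subset_insert a Y)
      simp only at this
      rw [Finset.erase_insert_of_ne hab, Finset.insert_comm b a] at this
      exact this
    set X := ∑ b ∈ S, Ex q S (fun Y => f (insert a (insert b Y)) - f (insert a (Y.erase b)))
    set Z := ∑ b ∈ S, Ex q S (fun Y => f (insert b Y) - f (Y.erase b))
    have k1 := mul_le_mul_of_nonneg_left i1 (by linarith : 0 ≤ 1 - p)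
    have k2 := mul_le_mul_of_nonneg_left i2 h0
    have k3 : 0 ≤ (q - p) * ((q - p) * (Z - X)) :=
      mul_nonneg (by linarith) (mul_nonneg (by linarith) (by linarith))
    nlinarith

/-! Probabilities -/

def Pr (p : ℝ) (S : Finset ι) (B : Finset ι → Prop) : ℝ := Ex p S (fun Y => ind (B Y))

section
variable {p : ℝ} (h0 : 0 ≤ p) (h1 : p ≤ 1) (S : Finset ι)

lemma Pr_insert (p : ℝ) {a : ι} {S : Finset ι} (ha : a ∉ S) (B : Finset ι → Prop) :
    Pr p (insert a S) B = (1 - p) * Pr p S B + p * Pr p S (fun Y => B (insert a Y)) :=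
  Ex_insert p ha _

lemma Pr_mono (h0 : 0 ≤ p) (h1 : p ≤ 1) {A B : Finset ι → Prop} (h : ∀ Y ⊆ S, A Y → B Y) :
    Pr p S A ≤ Pr p S B := Ex_mono h0 h1 S fun Y hY => ind_mono (h Y hY)

lemma Pr_nonneg (h0 : 0 ≤ p) (h1 : p ≤ 1) (A : Finset ι → Prop) : 0 ≤ Pr p S A := by
  have := Ex_mono h0 h1 S (f := fun _ => 0) (g := fun Y => ind (A Y)) (fun Y _ => ind_nonneg _)
  rwa [Ex_const] at this

lemma Pr_le_one (h0 : 0 ≤ p) (h1 : p ≤ 1) (A : Finset ι → Prop) : Pr p S A ≤ 1 := by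
  have := Ex_mono h0 h1 S (g := fun _ => 1) (f := fun Y => ind (A Y)) (fun Y _ => ind_le_one _)
  rwa [Ex_const] at this

lemma Pr_not (A : Finset ι → Prop) : Pr p S (fun Y => ¬ A Y) = 1 - Pr p S A := by
  unfold Pr
  simp only [ind_not]
  rw [Ex_sub, Ex_const]

lemma Pr_or (h0 : 0 ≤ p) (h1 : p ≤ 1) (A B : Finset ι → Prop) :
    Pr p S (fun Y => A Y ∨ B Y) ≤ Pr p S A + Pr p S B := by
  unfold Pr
  rw [← Ex_add]
  refine Ex_mono h0 h1 S fun Y _ => ?_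
  by_cases h : A Y
  · rw [ind_true h, ind_true (Or.inl h)]; linarith [ind_nonneg (B Y)]
  · rw [ind_false h, zero_add]; exact ind_mono (fun h' => h'.resolve_left h)

lemma Pr_exists (h0 : 0 ≤ p) (h1 : p ≤ 1) {κ : Type*} (T : Finset κ) (A : κ → Finset ι → Prop) :
    Pr p S (fun Y => ∃ k ∈ T, A k Y) ≤ ∑ k ∈ T, Pr p S (A k) := by
  unfold Pr
  rw [← Ex_sum]
  refine Ex_mono h0 h1 S fun Y _ => ?_
  by_cases h : ∃ k ∈ T, A k Y
  · rw [ind_true h]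
    obtain ⟨k, hk, hA⟩ := h
    rw [← ind_true hA]
    exact Finset.single_le_sum (f := fun k => ind (A k Y)) (fun k _ => ind_nonneg _) hk
  · rw [ind_false h]; exact Finset.sum_nonneg fun k _ => ind_nonneg _

lemma Pr_mem_and (h0 : 0 ≤ p) (h1 : p ≤ 1) (a : ι) (B : Finset ι → Prop)
    (hB : ∀ Y, B (insert a Y) → B Y) :
    Pr p S (fun Y => a ∈ Y ∧ B Y) ≤ p * Pr p S B := by
  by_cases ha : a ∈ S
  · rw [← Finset.insert_erase ha]
    have hn := Finset.notMem_erase a S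
    rw [Pr_insert p hn, Pr_insert p hn]
    have e1 : Pr p (S.erase a) (fun Y => a ∈ Y ∧ B Y) ≤ 0 := by
      unfold Pr
      refine (Ex_mono h0 h1 (g := fun _ => 0) _ fun Y hY => ?_).trans_eq (Ex_const _ _ _)
      rw [ind_false]; rintro ⟨h, _⟩; exact hn (hY h)
    have e2 : Pr p (S.erase a) (fun Y => a ∈ insert a Y ∧ B (insert a Y)) ≤
        Pr p (S.erase a) (fun Y => B (insert a Y)) := Pr_mono _ h0 h1 fun Y _ h => h.2
    have e3 : Pr p (S.erase a) (fun Y => B (insert a Y)) ≤ Pr p (S.erase a) B :=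
      Pr_mono _ h0 h1 fun Y _ h => hB Y h
    have k1 := mul_le_mul_of_nonneg_left e1 (by linarith : 0 ≤ 1 - p)
    have k2 := mul_le_mul_of_nonneg_left e2 h0
    have k3 := mul_le_mul_of_nonneg_left e3 (mul_nonneg h0 (by linarith : 0 ≤ 1 - p))
    nlinarith
  · have : Pr p S (fun Y => a ∈ Y ∧ B Y) ≤ 0 := by
      unfold Pr
      refine (Ex_mono h0 h1 (g := fun _ => 0) _ fun Y hY => ?_).trans_eq (Ex_const _ _ _)
      rw [ind_false]; rintro ⟨h, _⟩; exact ha (hY h)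
    exact this.trans (mul_nonneg h0 (Pr_nonneg S h0 h1 B))

lemma Pr_mem_and_eq {a : ι} (ha : a ∈ S) (B : Finset ι → Prop)
    (hB : ∀ Y, B (insert a Y) ↔ B Y) :
    Pr p S (fun Y => a ∈ Y ∧ B Y) = p * Pr p S B := by
  rw [← Finset.insert_erase ha]
  have hn := Finset.notMem_erase a S
  rw [Pr_insert p hn, Pr_insert p hn]
  have e1 : Pr p (S.erase a) (fun Y => a ∈ Y ∧ B Y) = 0 := by
    unfold Pr
    refine (Ex_congr (g := fun _ => 0) _ fun Y hY => ?_).trans (Ex_const _ _ _)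
    rw [ind_false]; rintro ⟨h, _⟩; exact hn (hY h)
  rw [e1]
  simp only [hB, mem_insert_self, true_and]
  ring

/-- disjoint occurrence -/
def DOcc (A B : Finset ι → Prop) (Y : Finset ι) : Prop :=
  ∃ I J : Finset ι, I ⊆ Y ∧ J ⊆ Y ∧ Disjoint I J ∧ A I ∧ B J

def Incr (A : Finset ι → Prop) : Prop := ∀ ⦃X Y⦄, X ⊆ Y → A X → A Y

lemma DOcc_incr (A B : Finset ι → Prop) : Incr (DOcc A B) := by
  rintro X Y h ⟨I, J, hI, hJ, r⟩
  exact ⟨I, J, hI.trans h, hJ.trans h, r⟩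

/-- van den Berg–Kesten inequality (increasing events, `p ≤ 1/2`) -/
lemma BK (h0 : 0 ≤ p) (h2 : p ≤ 1 / 2) (A B : Finset ι → Prop) (hA : Incr A) (hB : Incr B) :
    Pr p S (DOcc A B) ≤ Pr p S A * Pr p S B := by
  have h1 : p ≤ 1 := by linarith
  induction S using Finset.induction_on generalizing A B with
  | empty =>
    simp only [Pr, Ex_empty]
    by_cases h : DOcc A B ∅
    · obtain ⟨I, J, hI, hJ, _, a, b⟩ := h
      rw [ind_true (hA hI a), ind_true (hB hJ b)]; linarith [ind_le_one (DOcc A B ∅)]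
    · rw [ind_false h]; exact mul_nonneg (ind_nonneg _) (ind_nonneg _)
  | insert a S ha ih =>
    rw [Pr_insert p ha, Pr_insert p ha, Pr_insert p ha]
    set A' : Finset ι → Prop := fun Y => A (insert a Y) with hA'
    set B' : Finset ι → Prop := fun Y => B (insert a Y) with hB'
    have iA' : Incr A' := fun X Y h => hA (Finset.insert_subset_insert a h)
    have iB' : Incr B' := fun X Y h => hB (Finset.insert_subset_insert a h)
    have x00 := ih A B hA hB
    have x10 := ih A' B iA' hB
    have x01 := ih A B' hA iB'
    have key : Pr p S (fun Y => DOcc A B (insert a Y)) ≤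
        Pr p S (DOcc A' B) + Pr p S (DOcc A B') - Pr p S (DOcc A B) := by
      unfold Pr
      rw [← Ex_add, ← Ex_sub]
      refine Ex_mono h0 h1 S fun Y hY => ?_
      have haY : a ∉ Y := fun h => ha (hY h)
      have s1 : DOcc A B Y → DOcc A' B Y := fun ⟨I, J, hI, hJ, hd, x, y⟩ =>
        ⟨I, J, hI, hJ, hd, hA (Finset.subset_insert a I) x, y⟩
      have s2 : DOcc A B Y → DOcc A B' Y := fun ⟨I, J, hI, hJ, hd, x, y⟩ =>
        ⟨I, J, hI, hJ, hd, x, hB (Finset.subset_insert a J) y⟩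
      have s3 : DOcc A B (insert a Y) → DOcc A' B Y ∨ DOcc A B' Y := by
        rintro ⟨I, J, hI, hJ, hd, x, y⟩
        by_cases haI : a ∈ I
        · left
          have haJ : a ∉ J := Finset.disjoint_left.mp hd haI
          refine ⟨I.erase a, J, ?_, ?_, ?_, ?_, y⟩
          · rwa [← Finset.subset_insert_iff]
          · exact (Finset.subset_insert_iff_of_notMem haJ).mp hJ
          · exact Finset.disjoint_of_subset_left (Finset.erase_subset _ _) hd
          · simp only [hA']; rwa [Finset.insert_erase haI]
        · right
          refine ⟨I, J.erase a, ?_, ?_, ?_, x, ?_⟩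
          · exact (Finset.subset_insert_iff_of_notMem haI).mp hI
          · rwa [← Finset.subset_insert_iff]
          · exact Finset.disjoint_of_subset_right (Finset.erase_subset _ _) hd
          · exact hB (by intro z hz; by_cases h : z = a; simp [h]; simp [h, hz]) y
      by_cases q0 : DOcc A B Y
      · rw [ind_true q0, ind_true (s1 q0), ind_true (s2 q0)]
        linarith [ind_le_one (DOcc A B (insert a Y))]
      · rw [ind_false q0]
        by_cases q : DOcc A B (insert a Y)
        · rcases s3 q with h | h
          · rw [ind_true h]; linarith [ind_le_one (DOcc A B (insert a Y)), ind_nonneg (DOcc A B' Y)]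
          · rw [ind_true h]; linarith [ind_le_one (DOcc A B (insert a Y)), ind_nonneg (DOcc A' B Y)]
        · rw [ind_false q]; linarith [ind_nonneg (DOcc A' B Y), ind_nonneg (DOcc A B' Y)]
    have dA : Pr p S A ≤ Pr p S A' := Pr_mono S h0 h1 fun Y _ => hA (Finset.subset_insert a Y)
    have dB : Pr p S B ≤ Pr p S B' := Pr_mono S h0 h1 fun Y _ => hB (Finset.subset_insert a Y)
    have k0 := mul_le_mul_of_nonneg_left key h0
    have k1 := mul_le_mul_of_nonneg_left x00 (by linarith : 0 ≤ 1 - 2 * p)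
    have k2 := mul_le_mul_of_nonneg_left x10 h0
    have k3 := mul_le_mul_of_nonneg_left x01 h0
    have k4 : 0 ≤ p ^ 2 * ((Pr p S A' - Pr p S A) * (Pr p S B' - Pr p S B)) :=
      mul_nonneg (sq_nonneg p) (mul_nonneg (by linarith) (by linarith))
    nlinarith

/-- many events occurring disjointly -/
def MOcc {κ : Type*} (T : Finset κ) (A : κ → Finset ι → Prop) (Y : Finset ι) : Prop :=
  ∃ I : κ → Finset ι, (∀ k ∈ T, I k ⊆ Y) ∧ (∀ k ∈ T, ∀ l ∈ T, k ≠ l → Disjoint (I k) (I l)) ∧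
    ∀ k ∈ T, A k (I k)

lemma MOcc_incr {κ : Type*} (T : Finset κ) (A : κ → Finset ι → Prop) : Incr (MOcc T A) := by
  rintro X Y h ⟨I, hI, r⟩
  exact ⟨I, fun k hk => (hI k hk).trans h, r⟩

lemma BK_prod (h0 : 0 ≤ p) (h2 : p ≤ 1 / 2) {κ : Type*} [DecidableEq κ] (T : Finset κ)
    (A : κ → Finset ι → Prop) (hA : ∀ k, Incr (A k)) :
    Pr p S (MOcc T A) ≤ ∏ k ∈ T, Pr p S (A k) := by
  have h1 : p ≤ 1 := by linarith
  induction T using Finset.induction_on with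
  | empty => simpa using Pr_le_one S h0 h1 _
  | insert a T ha ih =>
    rw [Finset.prod_insert ha]
    refine (Pr_mono S h0 h1 (B := DOcc (A a) (MOcc T A)) ?_).trans
      ((BK S h0 h2 _ _ (hA a) (MOcc_incr T A)).trans
        (mul_le_mul_of_nonneg_left ih (Pr_nonneg S h0 h1 _)))
    rintro Y - ⟨I, h1, h2, h3⟩
    refine ⟨I a, T.biUnion I, h1 a (by simp), ?_, ?_, h3 a (by simp), ?_⟩
    · exact Finset.biUnion_subset.mpr fun k hk => h1 k (by simp [hk])
    · rw [Finset.disjoint_biUnion_right]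
      exact fun k hk => h2 a (by simp) k (by simp [hk]) (fun h => ha (h ▸ hk))
    · exact ⟨I, fun k hk => Finset.subset_biUnion_of_mem I hk,
        fun k hk l hl => h2 k (by simp [hk]) l (by simp [hl]), fun k hk => h3 k (by simp [hk])⟩

end
end
end AL

namespace AL
noncomputable section

section comb
variable {V : Type} [DecidableEq V]

def NB : ℕ → Finset V → V → Finset (Finset V) → Prop
  | 0, _, _, _ => True
  | k + 1, τ, u0, Y => ∃ w, w ∉ τ ∧ w ≠ u0 ∧ insert w τ ∈ Y ∧
      ∀ u ∈ τ, NB k ((insert w τ).erase u) u Y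

def InCL : ℕ → Finset V → V → Finset (Finset V) → Finset V → Prop
  | 0, _, _, _, _ => False
  | k + 1, τ, u0, Y, f => ∃ w, w ∉ τ ∧ w ≠ u0 ∧ insert w τ ∈ Y ∧
      (f = insert w τ ∨ ∃ u ∈ τ, InCL k ((insert w τ).erase u) u Y f)

def EV : ℕ → Finset V → V → Finset V → Finset (Finset V) → Prop
  | 0, _, _, _, _ => False
  | l + 1, s, v, F, Y => ∃ u ∈ s, u ≠ v ∧ ∃ w, w ∉ s ∧ insert w (s.erase u) ∈ Y ∧
      (w ∈ F ∨ (w ∉ F ∧ EV l (insert w (s.erase u)) w (insert w F) Y))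

def GV (k : ℕ) (σ : Finset V) (u1 : V) :
    ℕ → Finset V → V → Finset V → Finset (Finset V) → Prop
  | 0, _, _, _, _ => False
  | l + 1, s, u, F, Y => ∃ w, w ∉ s ∧ insert w (s.erase u) ∈ Y ∧
      (w ∈ F ∨ (w ∉ F ∧ (EV k σ u1 (insert w F) Y ∨
        ∃ u' ∈ s.erase u, GV k σ u1 l (insert w (s.erase u)) u' (insert w F) Y)))

lemma NB_incr (k : ℕ) (τ : Finset V) (u0 : V) : Incr (NB k τ u0) := by
  induction k generalizing τ u0 with
  | zero => intro _ _ _ _; trivial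
  | succ k ih =>
    rintro X Y h ⟨w, h1, h2, h3, h4⟩
    exact ⟨w, h1, h2, h h3, fun u hu => ih _ _ h (h4 u hu)⟩

lemma NB_cluster (k : ℕ) (τ : Finset V) (u0 : V) (Y Z : Finset (Finset V)) (h : NB k τ u0 Y)
    (hZ : ∀ f, InCL k τ u0 Y f → f ∈ Z) : NB k τ u0 Z := by
  induction k generalizing τ u0 with
  | zero => trivial
  | succ k ih =>
    obtain ⟨w, h1, h2, h3, h4⟩ := h
    exact ⟨w, h1, h2, hZ _ ⟨w, h1, h2, h3, Or.inl rfl⟩, fun u hu => ih _ _ (h4 u hu)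
      fun f hf => hZ f ⟨w, h1, h2, h3, Or.inr ⟨u, hu, hf⟩⟩⟩

lemma InCL_mem (k : ℕ) (τ : Finset V) (u0 : V) (Y : Finset (Finset V)) (f : Finset V)
    (h : InCL k τ u0 Y f) : f ∈ Y := by
  induction k generalizing τ u0 with
  | zero => exact h.elim
  | succ k ih =>
    obtain ⟨w, h1, h2, h3, h4 | ⟨u, _, h4⟩⟩ := h
    · exact h4 ▸ h3
    · exact ih _ _ h4

lemma C1 (k : ℕ) (s : Finset V) (u v : V) (F f : Finset V) (Y : Finset (Finset V))
    (h : InCL k (s.erase u) u Y f) (hu : u ∈ s) (huv : u ≠ v) (hf : f ⊆ F) : EV k s v F Y := by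
  induction k generalizing s u v F with
  | zero => exact h.elim
  | succ k ih =>
    obtain ⟨w, h1, h2, h3, h4⟩ := h
    have hw : w ∉ s := fun hw => h1 (Finset.mem_erase.mpr ⟨h2, hw⟩)
    refine ⟨u, hu, huv, w, hw, h3, ?_⟩
    by_cases hF : w ∈ F
    · exact Or.inl hF
    · refine Or.inr ⟨hF, ?_⟩
      rcases h4 with h4 | ⟨u', hu', h4⟩
      · exact absurd (hf (h4 ▸ Finset.mem_insert_self w _)) hF
      · refine ih _ u' w _ h4 (Finset.mem_insert_of_mem hu') ?_ (hf.trans (Finset.subset_insert _ _))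
        rintro rfl; exact hw (Finset.mem_of_mem_erase hu')

lemma EV_indep (l : ℕ) (s : Finset V) (v : V) (F f : Finset V) (Y : Finset (Finset V))
    (hv : v ∈ s) (hf : f ⊆ F) (h' : v ∉ f ∨ f = s) (h : EV l s v F (insert f Y)) :
    EV l s v F Y := by
  induction l generalizing s v F with
  | zero => exact h.elim
  | succ l ih =>
    obtain ⟨u, hu, huv, w, hw, h3, h4⟩ := h
    refine ⟨u, hu, huv, w, hw, ?_, ?_⟩
    · rcases Finset.mem_insert.mp h3 with h3 | h3
      · exfalso
        rcases h' with h' | h'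
        · apply h'; rw [← h3]
          exact Finset.mem_insert_of_mem (Finset.mem_erase.mpr ⟨huv.symm, hv⟩)
        · apply hw; rw [← h', ← h3]; exact Finset.mem_insert_self _ _
      · exact h3
    · rcases h4 with h4 | ⟨hF, h4⟩
      · exact Or.inl h4
      · exact Or.inr ⟨hF, ih _ _ _ (Finset.mem_insert_self _ _)
          (hf.trans (Finset.subset_insert _ _)) (Or.inl fun h => hF (hf h)) h4⟩

lemma C2 (k : ℕ) (σ : Finset V) (u1 u2 : V) (l : ℕ) (s : Finset V) (u : V) (F f : Finset V)
    (Y : Finset (Finset V)) (h : InCL l (s.erase u) u Y f) (h2 : InCL k (σ.erase u2) u2 Y f)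
    (h21 : u2 ≠ u1) (hu2 : u2 ∈ σ) (hs : s ⊆ F) (hu : u ∈ s) : GV k σ u1 l s u F Y := by
  induction l generalizing s u F with
  | zero => exact h.elim
  | succ l ih =>
    obtain ⟨w, i1, i2, i3, i4⟩ := h
    have hw : w ∉ s := fun hw => i1 (Finset.mem_erase.mpr ⟨i2, hw⟩)
    refine ⟨w, hw, i3, ?_⟩
    have hsub : insert w (s.erase u) ⊆ insert w F :=
      Finset.insert_subset_insert _ ((Finset.erase_subset _ _).trans hs)
    by_cases hF : w ∈ F
    · exact Or.inl hF
    · refine Or.inr ⟨hF, ?_⟩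
      rcases i4 with i4 | ⟨u', hu', i4⟩
      · left
        exact C1 k σ u2 u1 _ f Y h2 hu2 h21 (i4 ▸ hsub)
      · exact Or.inr ⟨u', hu', ih _ _ _ i4 hsub (Finset.mem_insert_of_mem hu')⟩

lemma GV_indep (k : ℕ) (σ : Finset V) (u1 : V) (l : ℕ) (s : Finset V) (u : V) (F f : Finset V)
    (Y : Finset (Finset V)) (hu1 : u1 ∈ σ) (hf : f ⊆ F) (h' : u1 ∉ f ∨ f = σ)
    (h'' : f = s ∨ ∃ x ∈ s.erase u, x ∉ f)
    (h : GV k σ u1 l s u F (insert f Y)) : GV k σ u1 l s u F Y := by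
  induction l generalizing s u F with
  | zero => exact h.elim
  | succ l ih =>
    obtain ⟨w, hw, h3, h4⟩ := h
    refine ⟨w, hw, ?_, ?_⟩
    · rcases Finset.mem_insert.mp h3 with h3 | h3
      · exfalso
        rcases h'' with h'' | ⟨x, hx, hxf⟩
        · apply hw; rw [← h'', ← h3]; exact Finset.mem_insert_self _ _
        · apply hxf; rw [← h3]; exact Finset.mem_insert_of_mem hx
      · exact h3
    · rcases h4 with h4 | ⟨hF, h4⟩
      · exact Or.inl h4
      · refine Or.inr ⟨hF, ?_⟩
        have hf' := hf.trans (Finset.subset_insert w F)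
        rcases h4 with h4 | ⟨u', hu', h4⟩
        · exact Or.inl (EV_indep _ _ _ _ _ _ hu1 hf' h' h4)
        · refine Or.inr ⟨u', hu', ih _ _ _ hf' (Or.inr ⟨w, ?_, fun h => hF (hf h)⟩) h4⟩
          refine Finset.mem_erase.mpr ⟨?_, Finset.mem_insert_self _ _⟩
          rintro rfl; exact hw (Finset.mem_of_mem_erase hu')

end comb

def eps (d : ℕ) (C : ℝ) : ℕ → ℕ → ℝ
  | 0, _ => 0
  | l + 1, m => (d + 1) * (m + C * eps d C l (m + 1))

def gam (d : ℕ) (C : ℝ) (k : ℕ) : ℕ → ℕ → ℝ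
  | 0, _ => 0
  | l + 1, m => m + C * (eps d C k (m + 1) + (d + 1) * gam d C k l (m + 1))

lemma eps_nonneg (d : ℕ) {C : ℝ} (hC : 0 ≤ C) (l m : ℕ) : 0 ≤ eps d C l m := by
  induction l generalizing m with
  | zero => simp [eps]
  | succ l ih => have := ih (m + 1); simp only [eps]; positivity

lemma gam_nonneg (d : ℕ) {C : ℝ} (hC : 0 ≤ C) (k l m : ℕ) : 0 ≤ gam d C k l m := by
  induction l generalizing m with
  | zero => simp [gam]
  | succ l ih =>
    have := ih (m + 1); have := eps_nonneg d hC k (m + 1); simp only [gam]; positivity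

section prob
variable {V : Type} [DecidableEq V] [Fintype V] {p C : ℝ}
variable (S : Finset (Finset V))

lemma sum_w_le (h0 : 0 ≤ p) (hC0 : 0 ≤ C) (hC : Fintype.card V * p ≤ C) {e : ℝ} (he : 0 ≤ e)
    (F : Finset V) (g : V → ℝ) (g1 : ∀ w ∈ F, g w ≤ p) (g2 : ∀ w ∉ F, g w ≤ p * (e * p)) :
    ∑ w, g w ≤ (#F + C * e) * p := by
  have hle : ∀ w, g w ≤ (if w ∈ F then p else 0) + p * (e * p) := by
    intro w
    by_cases hw : w ∈ F
    · have := g1 w hw; simp only [hw, if_true]; nlinarith [mul_nonneg h0 (mul_nonneg he h0)]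
    · have := g2 w hw; simp only [hw, if_false]; linarith
  refine (Finset.sum_le_sum fun w _ => hle w).trans ?_
  rw [Finset.sum_add_distrib]
  simp only [Finset.sum_ite_mem, Finset.univ_inter, Finset.sum_const, nsmul_eq_mul,
    Finset.card_univ]
  nlinarith [mul_le_mul_of_nonneg_right hC (mul_nonneg he h0)]

lemma EV_prob (d : ℕ) (h0 : 0 ≤ p) (h1 : p ≤ 1) (hC : Fintype.card V * p ≤ C) (l : ℕ)
    (s : Finset V) (v : V) (F : Finset V) (hs : #s = d + 1) (hsF : s ⊆ F) (hv : v ∈ s) :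
    Pr p S (EV l s v F) ≤ eps d C l #F * p := by
  have hC0 : 0 ≤ C := le_trans (by positivity) hC
  induction l generalizing s v F with
  | zero =>
    have : Pr p S (EV 0 s v F) = 0 := by
      unfold Pr; rw [← Ex_const p S 0]; exact Ex_congr S fun Y _ => ind_false fun h => h
    rw [this]; simp [eps]
  | succ l ih =>
    have e1 : Pr p S (EV (l+1) s v F) ≤ Pr p S (fun Y => ∃ u ∈ s, ∃ w ∈ (univ : Finset V),
        (w ∉ s ∧ insert w (s.erase u) ∈ Y ∧
      (w ∈ F ∨ (w ∉ F ∧ EV l (insert w (s.erase u)) w (insert w F) Y)))) := by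
      refine Pr_mono S h0 h1 ?_
      rintro Y _ ⟨u, hu, _, w, h⟩
      exact ⟨u, hu, w, Finset.mem_univ _, h⟩
    refine e1.trans ((Pr_exists S h0 h1 s _).trans ?_)
    have he := eps_nonneg d hC0 l (#F + 1)
    have e2 : ∀ u ∈ s, Pr p S (fun Y => ∃ w ∈ (univ : Finset V),
        (w ∉ s ∧ insert w (s.erase u) ∈ Y ∧
      (w ∈ F ∨ (w ∉ F ∧ EV l (insert w (s.erase u)) w (insert w F) Y)))) ≤
        (#F + C * eps d C l (#F + 1)) * p := by
      intro u hu
      refine (Pr_exists S h0 h1 _ _).trans ?_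
      refine sum_w_le h0 hC0 hC he F _ ?_ ?_
      · intro w hw
        have := Pr_mem_and (p := p) S h0 h1 (insert w (s.erase u)) (fun _ => True) (fun _ _ => trivial)
        refine le_trans (Pr_mono S h0 h1 ?_) (this.trans ?_)
        · rintro Y _ ⟨_, h, _⟩; exact ⟨h, trivial⟩
        · have := Pr_le_one (p := p) S h0 h1 (fun _ => True)
          nlinarith
      · intro w hw
        by_cases hws : w ∈ s
        · exact absurd (hsF hws) hw
        have hsub : insert w (s.erase u) ⊆ insert w F :=
          Finset.insert_subset_insert _ ((Finset.erase_subset _ _).trans hsF)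
        have := Pr_mem_and (p := p) S h0 h1 (insert w (s.erase u))
          (EV l (insert w (s.erase u)) w (insert w F))
          (fun Y => EV_indep _ _ _ _ _ _ (Finset.mem_insert_self _ _) hsub (Or.inr rfl))
        refine le_trans (Pr_mono S h0 h1 ?_) (this.trans ?_)
        · rintro Y _ ⟨_, h, h' | ⟨_, h'⟩⟩
          · exact absurd h' hw
          · exact ⟨h, h'⟩
        · refine mul_le_mul_of_nonneg_left ?_ h0
          have := ih (insert w (s.erase u)) w (insert w F) ?_ hsub (Finset.mem_insert_self _ _)
          · rwa [Finset.card_insert_of_notMem hw] at this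
          · rw [Finset.card_insert_of_notMem (fun h => hws (Finset.mem_of_mem_erase h)),
              Finset.card_erase_of_mem hu, hs]; rfl
    refine (Finset.sum_le_sum e2).trans ?_
    rw [Finset.sum_const, hs, nsmul_eq_mul]
    simp only [eps]; push_cast; linarith

lemma GV_prob (d : ℕ) (h0 : 0 ≤ p) (h1 : p ≤ 1) (hC : Fintype.card V * p ≤ C) (k : ℕ)
    (σ : Finset V) (hσ : #σ = d + 1) (u1 : V) (hu1 : u1 ∈ σ) (l : ℕ)
    (s : Finset V) (u : V) (F : Finset V) (hs : #s = d + 1) (hsF : s ⊆ F) (hu : u ∈ s)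
    (hσF : σ ⊆ F) (hu1s : u1 ∉ s.erase u) :
    Pr p S (GV k σ u1 l s u F) ≤ gam d C k l #F * p := by
  have hC0 : 0 ≤ C := le_trans (by positivity) hC
  induction l generalizing s u F with
  | zero =>
    have : Pr p S (GV k σ u1 0 s u F) = 0 := by
      unfold Pr; rw [← Ex_const p S 0]; exact Ex_congr S fun Y _ => ind_false fun h => h
    rw [this]; simp [gam]
  | succ l ih =>
    have e1 : Pr p S (GV k σ u1 (l+1) s u F) ≤ Pr p S (fun Y => ∃ w ∈ (univ : Finset V),
        (w ∉ s ∧ insert w (s.erase u) ∈ Y ∧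
      (w ∈ F ∨ (w ∉ F ∧ (EV k σ u1 (insert w F) Y ∨
        ∃ u' ∈ s.erase u, GV k σ u1 l (insert w (s.erase u)) u' (insert w F) Y))))) := by
      refine Pr_mono S h0 h1 ?_
      rintro Y _ ⟨w, h⟩
      exact ⟨w, Finset.mem_univ _, h⟩
    refine e1.trans ((Pr_exists S h0 h1 univ _).trans ?_)
    have he := eps_nonneg d hC0 k (#F + 1)
    have hg := gam_nonneg d hC0 k l (#F + 1)
    simp only [gam]
    refine sum_w_le h0 hC0 hC (by positivity) F _ ?_ ?_
    · intro w hw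
      have := Pr_mem_and (p := p) S h0 h1 (insert w (s.erase u)) (fun _ => True) (fun _ _ => trivial)
      refine le_trans (Pr_mono S h0 h1 ?_) (this.trans ?_)
      · rintro Y _ ⟨_, h, _⟩; exact ⟨h, trivial⟩
      · have := Pr_le_one (p := p) S h0 h1 (fun _ => True)
        nlinarith
    · intro w hw
      by_cases hws : w ∈ s
      · exact absurd (hsF hws) hw
      have hsub : insert w (s.erase u) ⊆ insert w F :=
        Finset.insert_subset_insert _ ((Finset.erase_subset _ _).trans hsF)
      have hcard : #(insert w (s.erase u)) = d + 1 := by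
        rw [Finset.card_insert_of_notMem (fun h => hws (Finset.mem_of_mem_erase h)),
              Finset.card_erase_of_mem hu, hs]; rfl
      have hu1' : u1 ∉ insert w (s.erase u) := by
        intro h
        rcases Finset.mem_insert.mp h with h | h
        · exact hw (h ▸ hσF hu1)
        · exact hu1s h
      have hσF' := hσF.trans (Finset.subset_insert w F)
      have := Pr_mem_and (p := p) S h0 h1 (insert w (s.erase u))
        (fun Y => EV k σ u1 (insert w F) Y ∨
        ∃ u' ∈ s.erase u, GV k σ u1 l (insert w (s.erase u)) u' (insert w F) Y)
        (by
          rintro Y (h | ⟨u', hu', h⟩)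
          · exact Or.inl (EV_indep _ _ _ _ _ _ hu1 hsub (Or.inl hu1') h)
          · exact Or.inr ⟨u', hu', GV_indep _ _ _ _ _ _ _ _ _ hu1 hsub (Or.inl hu1')
              (Or.inl rfl) h⟩)
      refine le_trans (Pr_mono S h0 h1 ?_) (this.trans ?_)
      · rintro Y _ ⟨_, h, h' | ⟨_, h'⟩⟩
        · exact absurd h' hw
        · exact ⟨h, h'⟩
      · refine mul_le_mul_of_nonneg_left ?_ h0
        refine (Pr_or S h0 h1 _ _).trans ?_
        have a1 := EV_prob S d h0 h1 hC k σ u1 (insert w F) hσ hσF' hu1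
        have a2 := Pr_exists (p := p) S h0 h1 (s.erase u)
          (fun u' Y => GV k σ u1 l (insert w (s.erase u)) u' (insert w F) Y)
        have a3 : ∀ u' ∈ s.erase u, Pr p S (fun Y => GV k σ u1 l (insert w (s.erase u)) u'
            (insert w F) Y) ≤ gam d C k l (#F + 1) * p := by
          intro u' hu'
          have := ih (insert w (s.erase u)) u' (insert w F) hcard hsub
            (Finset.mem_insert_of_mem hu') hσF' (fun h => hu1' (Finset.mem_of_mem_erase h))
          rwa [Finset.card_insert_of_notMem hw] at this
        have a4 := a2.trans (Finset.sum_le_sum a3)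
        rw [Finset.sum_const, Finset.card_erase_of_mem hu, hs, nsmul_eq_mul] at a4
        rw [Finset.card_insert_of_notMem hw] at a1
        have a5 : ((d + 1 - 1 : ℕ) : ℝ) = d := by simp
        rw [a5] at a4
        have := mul_nonneg hg h0
        nlinarith

def KK (d : ℕ) (C : ℝ) (k : ℕ) : ℝ := (d + 1) * (eps d C k (d + 1) + gam d C k k (d + 1))

lemma KK_nonneg (d : ℕ) {C : ℝ} (hC : 0 ≤ C) (k : ℕ) : 0 ≤ KK d C k := by
  have := eps_nonneg d hC k (d + 1)
  have := gam_nonneg d hC k k (d + 1)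
  unfold KK; positivity

lemma key_step (d : ℕ) (hd : 1 ≤ d) (h0 : 0 ≤ p) (h2 : p ≤ 1 / 2) (hC : Fintype.card V * p ≤ C)
    (k : ℕ) (σ : Finset V) (hσ : #σ = d + 1) (U : Finset V) (hU : U ⊆ σ) :
    Pr p S (fun Y => σ ∈ Y ∧ ∀ u ∈ U, NB k (σ.erase u) u Y) ≤
      p * (∏ u ∈ U, Pr p S (NB k (σ.erase u) u) + KK d C k * p) := by
  classical
  have h1 : p ≤ 1 := by linarith
  set Bad : Finset (Finset V) → Prop := fun Y => (∃ v ∈ σ, EV k σ v σ Y) ∨ (∃ u1 ∈ σ, GV k σ u1 k σ u1 σ Y)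
  have b1 : Pr p S (fun Y => σ ∈ Y ∧ Bad Y) ≤ p * (KK d C k * p) := by
    refine (Pr_mem_and S h0 h1 σ Bad ?_).trans (mul_le_mul_of_nonneg_left ?_ h0)
    · rintro Y (⟨v, hv, h⟩ | ⟨u1, hu1, h⟩)
      · exact Or.inl ⟨v, hv, EV_indep _ _ _ _ _ _ hv subset_rfl (Or.inr rfl) h⟩
      · exact Or.inr ⟨u1, hu1, GV_indep _ _ _ _ _ _ _ _ _ hu1 subset_rfl (Or.inr rfl)
          (Or.inl rfl) h⟩
    · refine (Pr_or S h0 h1 _ _).trans ?_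
      have a1 := (Pr_exists (p := p) S h0 h1 σ (fun v => EV k σ v σ)).trans
        (Finset.sum_le_sum fun v hv => EV_prob S d h0 h1 hC k σ v σ hσ subset_rfl hv)
      have a2 := (Pr_exists (p := p) S h0 h1 σ (fun v => GV k σ v k σ v σ)).trans
        (Finset.sum_le_sum fun v hv => GV_prob S d h0 h1 hC k σ hσ v hv k σ v σ hσ subset_rfl hv
          subset_rfl (Finset.notMem_erase _ _))
      rw [Finset.sum_const, hσ, nsmul_eq_mul] at a1 a2
      unfold KK
      push_cast at a1 a2
      linarith
  have b2 : Pr p S (DOcc (fun Y => σ ∈ Y) (MOcc U (fun u => NB k (σ.erase u) u))) ≤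
      p * ∏ u ∈ U, Pr p S (NB k (σ.erase u) u) := by
    refine (BK S h0 h2 _ _ (fun X Y h hX => h hX) (MOcc_incr _ _)).trans ?_
    have c1 : Pr p S (fun Y => σ ∈ Y) ≤ p := by
      have := Pr_mem_and (p := p) S h0 h1 σ (fun _ => True) (fun _ _ => trivial)
      refine le_trans (Pr_mono S h0 h1 ?_) (this.trans ?_)
      · intro Y _ h; exact ⟨h, trivial⟩
      · have := Pr_le_one (p := p) S h0 h1 (fun _ => True)
        nlinarith
    exact mul_le_mul c1 (BK_prod S h0 h2 U _ (fun u => NB_incr _ _ _)) (Pr_nonneg S h0 h1 _) h0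
  have b3 : Pr p S (fun Y => σ ∈ Y ∧ ∀ u ∈ U, NB k (σ.erase u) u Y) ≤
      Pr p S (fun Y => DOcc (fun Y => σ ∈ Y) (MOcc U (fun u => NB k (σ.erase u) u)) Y ∨
        (σ ∈ Y ∧ Bad Y)) := by
    refine Pr_mono S h0 h1 ?_
    rintro Y _ ⟨hY, hN⟩
    by_cases hB : Bad Y
    · exact Or.inr ⟨hY, hB⟩
    · left
      have hB1 : ∀ v ∈ σ, ¬ EV k σ v σ Y := fun v hv h => hB (Or.inl ⟨v, hv, h⟩)
      have hB2 : ∀ v ∈ σ, ¬ GV k σ v k σ v σ Y := fun v hv h => hB (Or.inr ⟨v, hv, h⟩)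
      refine ⟨{σ}, Y.erase σ, Finset.singleton_subset_iff.mpr hY, Finset.erase_subset _ _,
        by simp, Finset.mem_singleton_self _, ?_⟩
      refine ⟨fun u => Y.filter (InCL k (σ.erase u) u Y), ?_, ?_, ?_⟩
      · intro u hu f hf
        obtain ⟨hfY, hf⟩ := Finset.mem_filter.mp hf
        refine Finset.mem_erase.mpr ⟨?_, hfY⟩
        rintro rfl
        obtain ⟨v, hv, hvu⟩ := Finset.exists_mem_ne (s := f) (by omega) u
        exact hB1 v hv (C1 k f u v f f Y hf (hU hu) hvu.symm subset_rfl)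
      · intro u hu u' hu' hne
        rw [Finset.disjoint_left]
        intro f hf hf'
        have hf := (Finset.mem_filter.mp hf).2
        have hf' := (Finset.mem_filter.mp hf').2
        exact hB2 u (hU hu) (C2 k σ u u' k σ u σ f Y hf hf' hne.symm (hU hu') subset_rfl (hU hu))
      · intro u hu
        refine NB_cluster k _ _ Y _ (hN u hu) fun f hf => ?_
        exact Finset.mem_filter.mpr ⟨InCL_mem _ _ _ _ _ hf, hf⟩
  have := (b3.trans (Pr_or S h0 h1 _ _)).trans (add_le_add b2 b1)
  linarith

def bs (d : ℕ) (C p : ℝ) (n : ℕ) : ℕ → ℝ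
  | 0 => 1
  | k + 1 => 1 - (1 - min 1 (p * ((bs d C p n k) ^ d + KK d C k * p))) ^ n

lemma NB_prob (d : ℕ) (hd : 1 ≤ d) (h0 : 0 ≤ p) (h2 : p ≤ 1 / 2) (hC : Fintype.card V * p ≤ C)
    (k : ℕ) (τ : Finset V) (u0 : V) (hτ : #τ = d) :
    Pr p S (NB k τ u0) ≤ bs d C p (Fintype.card V) k := by
  have h1 : p ≤ 1 := by linarith
  have hC0 : 0 ≤ C := le_trans (by positivity) hC
  induction k generalizing τ u0 with
  | zero => exact Pr_le_one S h0 h1 _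
  | succ k ih =>
    set m : ℝ := min 1 (p * ((bs d C p (Fintype.card V) k) ^ d + KK d C k * p)) with hm
    set A : V → Finset (Finset V) → Prop := fun w Y =>
      insert w τ ∈ Y ∧ ∀ u ∈ τ, NB k ((insert w τ).erase u) u Y
    have hb0 : 0 ≤ bs d C p (Fintype.card V) k := (Pr_nonneg S h0 h1 _).trans (ih τ u0 hτ)
    have hm0 : 0 ≤ m := by
      have := KK_nonneg d hC0 k
      refine le_min zero_le_one (by positivity)
    have hm1 : m ≤ 1 := min_le_left _ _
    have hA : ∀ w ∉ τ, Pr p S (A w) ≤ m := by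
      intro w hw
      refine le_min (Pr_le_one S h0 h1 _) ?_
      refine (key_step S d hd h0 h2 hC k (insert w τ) (by rw [Finset.card_insert_of_notMem hw, hτ]) τ
        (Finset.subset_insert _ _)).trans ?_
      refine mul_le_mul_of_nonneg_left ?_ h0
      have : ∏ u ∈ τ, Pr p S (NB k ((insert w τ).erase u) u) ≤
          ∏ u ∈ τ, bs d C p (Fintype.card V) k := by
        refine Finset.prod_le_prod (fun u _ => Pr_nonneg S h0 h1 _) fun u hu => ih _ _ ?_
        rw [Finset.card_erase_of_mem (Finset.mem_insert_of_mem hu),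
          Finset.card_insert_of_notMem hw, hτ]; rfl
      rw [Finset.prod_const, hτ] at this
      linarith
    set T : Finset V := univ.filter (fun w => w ∉ τ ∧ w ≠ u0)
    have hh := harris_prod h0 h1 S T (fun w Y => ind (¬ A w Y)) (by
      intro w X Y hXY
      refine ind_mono fun h h' => h ⟨hXY h'.1, fun u hu => NB_incr _ _ _ hXY (h'.2 u hu)⟩)
      (fun _ _ => ind_nonneg _)
    have i1 : (1 - m) ^ (Fintype.card V) ≤ ∏ w ∈ T, Ex p S (fun Y => ind (¬ A w Y)) := by
      have : ∏ w ∈ T, (1 - m) ≤ ∏ w ∈ T, Ex p S (fun Y => ind (¬ A w Y)) := by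
        refine Finset.prod_le_prod (fun _ _ => by linarith) fun w hw => ?_
        have e : Ex p S (fun Y => ind (¬ A w Y)) = 1 - Pr p S (A w) := Pr_not S (A w)
        rw [e]
        have := hA w (Finset.mem_filter.mp hw).2.1
        linarith
      rw [Finset.prod_const] at this
      exact (pow_le_pow_of_le_one (by linarith) (by linarith) (Finset.card_le_univ T)).trans this
    have i2 : Ex p S (fun Y => ∏ w ∈ T, ind (¬ A w Y)) ≤ Pr p S (fun Y => ¬ NB (k+1) τ u0 Y) := by
      refine Ex_mono h0 h1 S fun Y _ => ?_
      by_cases h : NB (k+1) τ u0 Y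
      · obtain ⟨w, w1, w2, w3⟩ := h
        rw [Finset.prod_eq_zero (i := w)]
        · exact ind_nonneg _
        · exact Finset.mem_filter.mpr ⟨Finset.mem_univ _, w1, w2⟩
        · exact ind_false (not_not.mpr w3)
      · rw [ind_true h]
        exact Finset.prod_le_one (fun _ _ => ind_nonneg _) (fun _ _ => ind_le_one _)
    rw [Pr_not] at i2
    show _ ≤ 1 - (1 - m) ^ (Fintype.card V)
    linarith

lemma core_prob (d : ℕ) (hd : 1 ≤ d) (h0 : 0 ≤ p) (h2 : p ≤ 1 / 2) (hC : Fintype.card V * p ≤ C)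
    (k : ℕ) (σ : Finset V) (hσ : #σ = d + 1) :
    Pr p S (fun Y => σ ∈ Y ∧ ∀ u ∈ σ, NB k (σ.erase u) u Y) ≤
      p * ((bs d C p (Fintype.card V) k) ^ (d + 1) + KK d C k * p) := by
  have h1 : p ≤ 1 := by linarith
  refine (key_step S d hd h0 h2 hC k σ hσ σ subset_rfl).trans (mul_le_mul_of_nonneg_left ?_ h0)
  have : ∏ u ∈ σ, Pr p S (NB k (σ.erase u) u) ≤ ∏ u ∈ σ, bs d C p (Fintype.card V) k := by
    refine Finset.prod_le_prod (fun u _ => Pr_nonneg S h0 h1 _) fun u hu =>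
      NB_prob S d hd h0 h2 hC k _ _ ?_
    rw [Finset.card_erase_of_mem hu, hσ]; rfl
  rw [Finset.prod_const, hσ] at this
  linarith

end prob
end
end AL

namespace AL
noncomputable section

section lin
variable {ι : Type*} [DecidableEq ι] {W : Type*} [AddCommGroup W] [Module ℝ W] [FiniteDimensional ℝ W]
variable (b : ι → W)

def sp (Y : Finset ι) : Submodule ℝ W := Submodule.span ℝ (b '' (Y : Set ι))

def rk (Y : Finset ι) : ℝ := (Module.finrank ℝ (sp b Y) : ℝ)

lemma sp_mono {Y Z : Finset ι} (h : Y ⊆ Z) : sp b Y ≤ sp b Z :=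
  Submodule.span_mono (Set.image_mono (by exact_mod_cast h))

lemma sp_insert (a : ι) (Y : Finset ι) : sp b (insert a Y) = Submodule.span ℝ {b a} ⊔ sp b Y := by
  unfold sp; rw [Finset.coe_insert, Set.image_insert_eq, Submodule.span_insert]

lemma rk_insert (a : ι) (Y : Finset ι) : rk b (insert a Y) = rk b Y + ind (b a ∉ sp b Y) := by
  unfold rk
  rw [sp_insert]
  by_cases h : b a ∈ sp b Y
  · rw [ind_false (not_not.mpr h), sup_eq_right.mpr, add_zero]
    rwa [Submodule.span_singleton_le_iff_mem]
  · rw [ind_true h]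
    have hb : b a ≠ 0 := fun h' => h (h' ▸ Submodule.zero_mem _)
    have h1 := Submodule.finrank_sup_add_finrank_inf_eq (Submodule.span ℝ {b a}) (sp b Y)
    have h2 : Submodule.span ℝ {b a} ⊓ sp b Y = ⊥ :=
      (Submodule.disjoint_span_singleton' hb).mpr h |>.symm.eq_bot
    rw [h2, finrank_bot, finrank_span_singleton hb] at h1
    have : Module.finrank ℝ ↥(Submodule.span ℝ {b a} ⊔ sp b Y) = Module.finrank ℝ (sp b Y) + 1 := by
      omega
    rw [this]; push_cast; ring

lemma rk_diff (a : ι) (Y : Finset ι) :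
    rk b (insert a Y) - rk b (Y.erase a) = ind (b a ∉ sp b (Y.erase a)) := by
  have : insert a Y = insert a (Y.erase a) := by
    ext x; by_cases hx : x = a <;> simp [hx]
  rw [this, rk_insert]; ring

lemma rk_diff_anti (a : ι) : Antitone (fun Y => rk b (insert a Y) - rk b (Y.erase a)) := by
  intro X Y h
  simp only [rk_diff]
  exact ind_mono fun h1 h2 => h1 (sp_mono b (Finset.erase_subset_erase a h) h2)

def nul (Y : Finset ι) : ℝ := #Y - rk b Y

lemma nul_lip (a : ι) (Y : Finset ι) : |nul b (insert a Y) - nul b Y| ≤ 1 := by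
  unfold nul
  by_cases h : a ∈ Y
  · rw [Finset.insert_eq_of_mem h]; simp
  · rw [Finset.card_insert_of_notMem h, rk_insert]
    have := ind_nonneg (b a ∉ sp b Y)
    have := ind_le_one (b a ∉ sp b Y)
    push_cast
    rw [abs_le]; constructor <;> linarith

lemma rk_le (Y : Finset ι) : rk b Y ≤ Module.finrank ℝ W := by
  unfold rk; exact_mod_cast Submodule.finrank_le _

def LI (Y : Finset ι) : Prop := ∀ g : ι → ℝ, ∑ a ∈ Y, g a • b a = 0 → ∀ a ∈ Y, g a = 0

lemma LI_anti {Y Z : Finset ι} (h : Y ⊆ Z) (hZ : LI b Z) : LI b Y := by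
  intro g hg a ha
  have := hZ (fun x => if x ∈ Y then g x else 0) ?_ a (h ha)
  · simpa [ha] using this
  · simp only [ite_smul, zero_smul]
    rw [Finset.sum_ite_mem, Finset.inter_eq_right.mpr h]; exact hg

lemma exists_of_mem_sp {a : ι} {Y : Finset ι} (h : b a ∈ sp b Y) :
    ∃ g : ι → ℝ, ∑ x ∈ Y, g x • b x = b a := by
  obtain ⟨c, hc⟩ := (Submodule.mem_span_image_finset_iff_exists_fun ℝ).mp h
  refine ⟨fun x => if h : x ∈ Y then c ⟨x, h⟩ else 0, ?_⟩
  rw [← hc, ← Finset.sum_coe_sort]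
  refine Finset.sum_congr rfl fun x _ => ?_
  simp

lemma nul_LI (Y : Finset ι) (h : LI b Y) : nul b Y = 0 := by
  induction Y using Finset.induction_on with
  | empty =>
    have : sp b ∅ = ⊥ := by unfold sp; rw [Finset.coe_empty, Set.image_empty, Submodule.span_empty]
    unfold nul rk; rw [this]; simp
  | insert y Y hy ih =>
    have h1 := ih (LI_anti b (Finset.subset_insert _ _) h)
    unfold nul at h1 ⊢
    rw [Finset.card_insert_of_notMem hy, rk_insert, ind_true]
    · push_cast; linarith
    · intro hm
      obtain ⟨g, hg⟩ := exists_of_mem_sp b hm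
      have := h (fun x => if x = y then -1 else g x) ?_ y (Finset.mem_insert_self _ _)
      · simp at this
      · rw [Finset.sum_insert hy]
        have : ∑ x ∈ Y, (if x = y then (-1:ℝ) else g x) • b x = b y := by
          rw [← hg]; refine Finset.sum_congr rfl fun x hx => ?_
          rw [if_neg]; rintro rfl; exact hy hx
        rw [this]; simp
end lin

section cplx
variable {V : Type} [Fintype V] [DecidableEq V] [LinearOrder V]

def bd (d : ℕ) (σ : Finset V) : {τ : Finset V // #τ = d} → ℝ := fun τ =>
  ∑ v : V, if v ∉ τ.1 ∧ insert v τ.1 = σ then (-1 : ℝ) ^ (#(τ.1.filter (fun u => u < v))) else 0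

lemma bd_erase_ne (d : ℕ) (σ : Finset V) (u : V) (hu : u ∈ σ) (h : #(σ.erase u) = d) :
    bd d σ ⟨σ.erase u, h⟩ ≠ 0 := by
  unfold bd
  rw [Finset.sum_eq_single u]
  · rw [if_pos ⟨Finset.notMem_erase _ _, Finset.insert_erase hu⟩]
    exact pow_ne_zero _ (by norm_num)
  · intro v _ hv
    rw [if_neg]
    rintro ⟨h1, h2⟩
    apply h1
    exact Finset.mem_erase.mpr ⟨hv, h2 ▸ Finset.mem_insert_self _ _⟩
  · intro h; exact absurd (Finset.mem_univ _) h

lemma bd_ne (d : ℕ) (σ : Finset V) (τ : {τ : Finset V // #τ = d}) (h : bd d σ τ ≠ 0) :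
    ∃ v, v ∉ τ.1 ∧ insert v τ.1 = σ := by
  unfold bd at h
  obtain ⟨v, _, hv⟩ := Finset.exists_ne_zero_of_sum_ne_zero h
  refine ⟨v, ?_⟩
  by_contra hc
  rw [if_neg hc] at hv; exact hv rfl

lemma NB_of_closed (k : ℕ) (Z : Finset (Finset V))
    (hZ : ∀ σ ∈ Z, ∀ u ∈ σ, ∃ w, w ∉ σ.erase u ∧ w ≠ u ∧ insert w (σ.erase u) ∈ Z) :
    ∀ σ ∈ Z, ∀ u ∈ σ, NB k (σ.erase u) u Z := by
  induction k with
  | zero => intros; trivial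
  | succ k ih =>
    intro σ hσ u hu
    obtain ⟨w, h1, h2, h3⟩ := hZ σ hσ u hu
    exact ⟨w, h1, h2, h3, fun u' hu' => ih _ h3 u' (Finset.mem_insert_of_mem hu')⟩

lemma NB_of_sp (d k : ℕ) (Y : Finset (Finset V)) (a : Finset V) (ha : a ∈ Y)
    (hY : ∀ σ ∈ Y, #σ = d + 1) (h : bd d a ∈ sp (bd d) (Y.erase a)) :
    ∀ u ∈ a, NB k (a.erase u) u Y := by
  classical
  obtain ⟨g0, hg0⟩ := exists_of_mem_sp _ h
  set g : Finset V → ℝ := fun x => if x = a then -1 else g0 x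
  have hg : ∑ x ∈ Y, g x • bd d x = 0 := by
    rw [← Finset.insert_erase ha, Finset.sum_insert (Finset.notMem_erase _ _)]
    have : ∑ x ∈ Y.erase a, g x • bd d x = bd d a := by
      rw [← hg0]; refine Finset.sum_congr rfl fun x hx => ?_
      simp only [g]; rw [if_neg (Finset.ne_of_mem_erase hx)]
    rw [this]; simp [g]
  set Z := Y.filter (fun x => g x ≠ 0)
  have hZ : ∀ σ ∈ Z, ∀ u ∈ σ, ∃ w, w ∉ σ.erase u ∧ w ≠ u ∧ insert w (σ.erase u) ∈ Z := by
    intro σ hσ u hu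
    obtain ⟨hσY, hgσ⟩ := Finset.mem_filter.mp hσ
    have hc : #(σ.erase u) = d := by rw [Finset.card_erase_of_mem hu, hY σ hσY]; rfl
    have h0 := congrFun hg ⟨σ.erase u, hc⟩
    rw [Finset.sum_apply, ← Finset.insert_erase hσY,
      Finset.sum_insert (Finset.notMem_erase _ _)] at h0
    simp only [Pi.smul_apply, smul_eq_mul, Pi.zero_apply] at h0
    have hne : g σ * bd d σ ⟨σ.erase u, hc⟩ ≠ 0 := mul_ne_zero hgσ (bd_erase_ne d σ u hu hc)
    have hne2 : ∑ x ∈ Y.erase σ, g x * bd d x ⟨σ.erase u, hc⟩ ≠ 0 := by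
      intro h'; rw [h', add_zero] at h0; exact hne h0
    obtain ⟨σ', hσ', hx⟩ := Finset.exists_ne_zero_of_sum_ne_zero hne2
    obtain ⟨w, hw1, hw2⟩ := bd_ne d σ' _ (right_ne_zero_of_mul hx)
    refine ⟨w, hw1, ?_, ?_⟩
    · rintro rfl
      simp only [Finset.insert_erase hu] at hw2
      exact Finset.ne_of_mem_erase hσ' hw2.symm
    · simp only at hw2
      rw [hw2]
      exact Finset.mem_filter.mpr ⟨Finset.mem_of_mem_erase hσ', left_ne_zero_of_mul hx⟩
  have haZ : a ∈ Z := Finset.mem_filter.mpr ⟨ha, by simp [g]⟩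
  intro u hu
  exact NB_incr _ _ _ (Finset.filter_subset _ _) (NB_of_closed k Z hZ a haZ u hu)

lemma diff_lb {p C : ℝ} (d : ℕ) (hd : 1 ≤ d) (h0 : 0 < p) (h2 : p ≤ 1 / 2)
    (hC : Fintype.card V * p ≤ C) (k : ℕ) (a : Finset V) (ha : #a = d + 1) :
    1 - ((bs d C p (Fintype.card V) k) ^ (d + 1) + KK d C k * p) ≤
    Ex p (powersetCard (d + 1) univ) (fun Y => rk (bd d) (insert a Y) - rk (bd d) (Y.erase a)) := by
  have h1 : p ≤ 1 := by linarith
  set S : Finset (Finset V) := powersetCard (d + 1) univ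
  have haS : a ∈ S := Finset.mem_powersetCard.mpr ⟨Finset.subset_univ _, ha⟩
  simp only [rk_diff]
  have e : Ex p S (fun Y => ind (bd d a ∉ sp (bd d) (Y.erase a))) =
      1 - Pr p S (fun Y => bd d a ∈ sp (bd d) (Y.erase a)) := Pr_not S _
  rw [e]
  have e2 := Pr_mem_and_eq (p := p) S haS (fun Y => bd d a ∈ sp (bd d) (Y.erase a))
    (fun Y => by rw [Finset.erase_insert_eq_erase])
  have e3 : Pr p S (fun Y => a ∈ Y ∧ bd d a ∈ sp (bd d) (Y.erase a)) ≤
      p * ((bs d C p (Fintype.card V) k) ^ (d + 1) + KK d C k * p) := by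
    refine le_trans (Pr_mono S h0.le h1 ?_) (core_prob S d hd h0.le h2 hC k a ha)
    rintro Y hY ⟨haY, h⟩
    exact ⟨haY, NB_of_sp d k Y a haY (fun σ hσ => (Finset.mem_powersetCard.mp (hY hσ)).2) h⟩
  rw [e2] at e3
  have := le_of_mul_le_mul_left e3 h0
  linarith

lemma LI_of_top (d : ℕ) (K Y : Finset (Finset V)) (hY : ∀ σ, σ ∈ Y ↔ σ ∈ K ∧ #σ = d + 1)
    (h : TopHomologyZero K d ℝ) : LI (bd d) Y := by
  intro g hg a ha
  have := h (fun s => g s.1) ?_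
  · exact congrFun this ⟨a, (hY a).mp ha⟩
  · funext τ
    have h0 := congrFun hg ⟨τ.1, τ.2.2⟩
    rw [Finset.sum_apply] at h0
    simp only [Pi.smul_apply, smul_eq_mul, Pi.zero_apply, bd, Finset.mul_sum] at h0
    rw [Finset.sum_comm] at h0
    simp only [chainBoundary, Pi.zero_apply]
    refine Eq.trans ?_ h0
    refine Finset.sum_congr rfl fun v _ => ?_
    by_cases hv : v ∉ τ.1 ∧ insert v τ.1 ∈ K
    · rw [dif_pos hv, Finset.sum_eq_single (insert v τ.1)]
      · rw [if_pos ⟨hv.1, rfl⟩]; simp [mul_comm]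
      · intro σ _ hσ; rw [if_neg, mul_zero]; rintro ⟨_, h⟩; exact hσ h.symm
      · intro hn; exfalso; apply hn; rw [hY]
        exact ⟨hv.2, by rw [Finset.card_insert_of_notMem hv.1, τ.2.2]⟩
    · rw [dif_neg hv, Finset.sum_eq_zero]
      intro σ hσ
      rw [if_neg, mul_zero]
      rintro ⟨h1, h2⟩; exact hv ⟨h1, h2 ▸ ((hY σ).mp hσ).1⟩

end cplx
end
end AL

namespace AL
noncomputable section

def cf (d : ℕ) (t : ℝ) : ℝ := -Real.log t / (1 - t) ^ d
def hh (d : ℕ) (t : ℝ) : ℝ := 1 - t + d * (t * Real.log t)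
def gg (d : ℕ) (t : ℝ) : ℝ := (d + 1) * (1 - t) + (1 + d * t) * Real.log t
def ht (d : ℕ) (t : ℝ) : ℝ := 1 - (1 - t) ^ (d + 1)
def Kf (d : ℕ) (t : ℝ) : ℝ := -(cf d t * ht d t) + (d + 1) * (t - t * Real.log t)

lemma gg_deriv (d : ℕ) {t : ℝ} (ht : 0 < t) : HasDerivAt (gg d) (hh d t / t) t := by
  have h1 := ((hasDerivAt_id t).const_sub 1).const_mul ((d : ℝ) + 1)
  have h2 := (((hasDerivAt_id t).const_mul (d : ℝ)).const_add 1).mul (Real.hasDerivAt_log ht.ne')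
  have := h1.add h2
  refine HasDerivAt.congr_deriv (this : HasDerivAt (gg d) _ t) ?_
  unfold hh; simp only [id]; field_simp; ring

lemma cf_deriv (d : ℕ) (hd : 1 ≤ d) {t : ℝ} (ht : 0 < t) (h1 : t < 1) :
    HasDerivAt (cf d) (-(hh d t / (t * (1 - t) ^ (d + 1)))) t := by
  obtain ⟨e, rfl⟩ : ∃ e, d = e + 1 := ⟨d - 1, by omega⟩
  have h1' : 0 < 1 - t := by linarith
  have a := (Real.hasDerivAt_log ht.ne').neg
  have b := ((hasDerivAt_id t).const_sub 1).pow (e + 1)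
  have := a.div b (by simp only [Pi.pow_apply, id]; positivity)
  refine HasDerivAt.congr_deriv (this : HasDerivAt (cf (e+1)) _ t) ?_
  unfold hh; simp only [id, Pi.pow_apply, Pi.neg_apply, Nat.add_sub_cancel]; push_cast; field_simp; ring

lemma ht_deriv (d : ℕ) (t : ℝ) : HasDerivAt (ht d) ((d + 1) * (1 - t) ^ d) t := by
  have b := (((hasDerivAt_id t).const_sub 1).pow (d + 1)).const_sub 1
  refine HasDerivAt.congr_deriv (b : HasDerivAt (ht d) _ t) ?_
  simp

lemma Kf_deriv (d : ℕ) (hd : 1 ≤ d) {t : ℝ} (h0 : 0 < t) (h1 : t < 1) :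
    HasDerivAt (Kf d) (hh d t / (t * (1 - t) ^ (d + 1)) * ht d t) t := by
  have h1' : 0 < 1 - t := by linarith
  have a := ((cf_deriv d hd h0 h1).mul (ht_deriv d t)).neg
  have b := ((hasDerivAt_id t).sub ((hasDerivAt_id t).mul (Real.hasDerivAt_log h0.ne'))).const_mul
    ((d : ℝ) + 1)
  refine HasDerivAt.congr_deriv (a.add b : HasDerivAt (Kf d) _ t) ?_
  have : cf d t * (1 - t) ^ d = - Real.log t := by unfold cf; field_simp
  simp only [id]
  have e : t * t⁻¹ = 1 := mul_inv_cancel₀ h0.ne'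
  linear_combination (-(d+1 : ℝ)) * this - (d + 1 : ℝ) * e

lemma hh_neg (d : ℕ) (hd : 1 ≤ d) {t s : ℝ} (h0 : 0 < t) (hts : t < s) (hs : s < 1)
    (h : hh d t ≤ 0) : hh d s < 0 := by
  have hd' : (1:ℝ) ≤ d := by exact_mod_cast hd
  have ht1 : 0 < 1 - t := by linarith
  have hcx := Real.strictConvexOn_mul_log.2
  have h01 : (0:ℝ) < (1 - s) / (1 - t) := div_pos (by linarith) ht1
  have h02 : (0:ℝ) < (s - t) / (1 - t) := div_pos (by linarith) ht1
  have := hcx (Set.mem_Ici.mpr h0.le) (Set.mem_Ici.mpr zero_le_one) (ne_of_lt (by linarith : t < 1))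
    h01 h02 (by field_simp; ring)
  simp only [smul_eq_mul, Real.log_one, mul_zero, add_zero, mul_one] at this
  have e : (1 - s) / (1 - t) * t + (s - t) / (1 - t) = s := by field_simp; ring
  rw [e] at this
  unfold hh at *
  set a := (1 - s) / (1 - t)
  have ha : 0 < a := div_pos (by linarith) ht1
  have e2 : 1 - s = a * (1 - t) := by simp only [a]; field_simp
  rw [e2]
  have := mul_lt_mul_of_pos_left this (by linarith : (0:ℝ) < d)
  nlinarith [mul_nonneg ha.le (neg_nonneg.mpr h)]

lemma hh_pos (d : ℕ) (hd : 1 ≤ d) {x : ℝ} (hx0 : 0 < x) (hx1 : x < 1) (hg : gg d x = 0) {t : ℝ}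
    (h0 : 0 < t) (htx : t ≤ x) : 0 < hh d t := by
  by_contra hc
  push Not at hc
  have hanti : StrictAntiOn (gg d) (Set.Icc t 1) := by
    refine strictAntiOn_of_deriv_neg (convex_Icc _ _) ?_ ?_
    · intro s hs
      exact (gg_deriv d (lt_of_lt_of_le h0 hs.1)).continuousAt.continuousWithinAt
    · intro s hs
      rw [interior_Icc] at hs
      have hs0 : 0 < s := h0.trans hs.1
      rw [(gg_deriv d hs0).deriv]
      exact div_neg_of_neg_of_pos (hh_neg d hd h0 hs.1 hs.2 hc) hs0
  have := hanti ⟨htx, hx1.le⟩ ⟨by linarith, le_rfl⟩ hx1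
  rw [hg] at this
  simp [gg] at this

lemma gg_neg (d : ℕ) (hd : 1 ≤ d) {x : ℝ} (hx0 : 0 < x) (hx1 : x < 1) (hg : gg d x = 0) {t : ℝ}
    (h0 : 0 < t) (htx : t < x) : gg d t < 0 := by
  have hm : StrictMonoOn (gg d) (Set.Icc t x) := by
    refine strictMonoOn_of_deriv_pos (convex_Icc _ _) ?_ ?_
    · intro s hs
      exact (gg_deriv d (lt_of_lt_of_le h0 hs.1)).continuousAt.continuousWithinAt
    · intro s hs
      rw [interior_Icc] at hs
      have hs0 : 0 < s := h0.trans hs.1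
      rw [(gg_deriv d hs0).deriv]
      exact div_pos (hh_pos d hd hx0 hx1 hg hs0 hs.2.le) hs0
  have := hm ⟨le_rfl, htx.le⟩ ⟨htx.le, le_rfl⟩ htx
  rwa [hg] at this

lemma cf_anti (d : ℕ) (hd : 1 ≤ d) {x : ℝ} (hx0 : 0 < x) (hx1 : x < 1) (hg : gg d x = 0) :
    StrictAntiOn (cf d) (Set.Ioc 0 x) := by
  refine strictAntiOn_of_deriv_neg (convex_Ioc _ _) ?_ ?_
  · intro s hs
    exact (cf_deriv d hd hs.1 (by linarith [hs.2])).continuousAt.continuousWithinAt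
  · intro s hs
    rw [interior_Ioc] at hs
    have : 0 < 1 - s := by linarith [hs.2]
    rw [(cf_deriv d hd hs.1 (by linarith [hs.2])).deriv]
    have := hh_pos d hd hx0 hx1 hg hs.1 hs.2.le
    have := hs.1
    rw [neg_lt_zero]; positivity

lemma ht_mono (d : ℕ) {t s : ℝ} (hts : t ≤ s) (hs : s ≤ 1) : ht d t ≤ ht d s := by
  unfold ht
  have := pow_le_pow_left₀ (by linarith : 0 ≤ 1 - s) (by linarith : 1 - s ≤ 1 - t) (d + 1)
  linarith

lemma Kf_step (d : ℕ) (hd : 1 ≤ d) {x : ℝ} (hx0 : 0 < x) (hx1 : x < 1) (hg : gg d x = 0) {t s : ℝ}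
    (h0 : 0 < t) (hts : t ≤ s) (hs : s ≤ x) :
    Kf d s - Kf d t ≤ (cf d t - cf d s) * ht d s := by
  have hD : ∀ r, 0 < r → r < 1 → HasDerivAt (fun r => Kf d r + cf d r * ht d s) _ r :=
    fun r r0 r1 => (Kf_deriv d hd r0 r1).add ((cf_deriv d hd r0 r1).mul_const (ht d s))
  have hm : AntitoneOn (fun r => Kf d r + cf d r * ht d s) (Set.Icc t s) := by
    refine antitoneOn_of_deriv_nonpos (convex_Icc _ _) ?_ ?_ ?_
    · intro r hr
      exact (hD r (by linarith [hr.1]) (by linarith [hr.2])).continuousAt.continuousWithinAt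
    · intro r hr
      rw [interior_Icc] at hr
      exact (hD r (by linarith [hr.1]) (by linarith [hr.2])).differentiableAt.differentiableWithinAt
    · intro r hr
      rw [interior_Icc] at hr
      have r0 : 0 < r := by linarith [hr.1]
      have r1 : 0 < 1 - r := by linarith [hr.2]
      rw [(hD r r0 (by linarith)).deriv]
      have h1 := hh_pos d hd hx0 hx1 hg r0 (by linarith [hr.2])
      have h2 : 0 ≤ hh d r / (r * (1 - r) ^ (d + 1)) := by positivity
      have h3 := ht_mono d hr.2.le (by linarith)
      nlinarith
  have := hm ⟨le_rfl, hts⟩ ⟨hts, le_rfl⟩ hts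
  simp only at this
  linarith

lemma pow_lip (n : ℕ) {a b : ℝ} (hb : 0 ≤ b) (hba : b ≤ a) (ha : a ≤ 1) :
    a ^ n - b ^ n ≤ n * (a - b) := by
  induction n with
  | zero => simp
  | succ n ih =>
    have h1 : b ^ n ≤ 1 := pow_le_one₀ hb (by linarith)
    have h2 : 0 ≤ a ^ n - b ^ n := by linarith [pow_le_pow_left₀ hb hba n]
    have e : a ^ (n+1) - b ^ (n+1) = a * (a ^ n - b ^ n) + b ^ n * (a - b) := by ring
    rw [e]; push_cast
    nlinarith

lemma grid (d : ℕ) (hd : 1 ≤ d) {x : ℝ} (hx0 : 0 < x) (hx1 : x < 1) (hg : gg d x = 0) {c : ℝ}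
    (hc : cf d x < c) : ∃ (M : ℕ) (t : ℕ → ℝ), (∀ i ≤ M, 0 < t i ∧ t i ≤ x) ∧ cf d (t 0) ≤ c ∧
      (∀ i < M, cf d (t i) ≤ cf d (t (i + 1))) ∧
      0 < cf d (t 0) - (d + 1) + ∑ i ∈ range M, (cf d (t (i + 1)) - cf d (t i)) * ht d (t (i + 1)) := by
  have hcont : ContinuousAt (cf d) x := (cf_deriv d hd hx0 hx1).continuousAt
  have ev : ∀ᶠ t in nhds x, cf d t < c := hcont.eventually (gt_mem_nhds hc)
  have ev2 : ∀ᶠ t in nhds x, 0 < t := lt_mem_nhds hx0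
  obtain ⟨t0, htx, ht0c, ht0⟩ : ∃ t0, t0 < x ∧ cf d t0 < c ∧ 0 < t0 := by
    have := ((ev.and ev2).filter_mono nhdsWithin_le_nhds : ∀ᶠ t in nhdsWithin x (Set.Iio x), _)
    obtain ⟨t, h1, h2⟩ := (this.and self_mem_nhdsWithin).exists
    exact ⟨t, h2, h1.1, h1.2⟩
  have hgn := gg_neg d hd hx0 hx1 hg ht0 htx
  have hJ : Kf d t0 + cf d t0 - (d + 1) = - gg d t0 := by
    have h1' : 0 < 1 - t0 := by linarith
    have : cf d t0 * (1 - t0) ^ d = - Real.log t0 := by unfold cf; field_simp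
    unfold Kf ht gg
    linear_combination (1 - t0) * this
  obtain ⟨a, ha0, hat, haK⟩ : ∃ a, 0 < a ∧ a < t0 ∧ Kf d a < -gg d t0 / 2 := by
    have hcn : ContinuousAt (fun t : ℝ => ((d:ℝ) + 1) * (t - t * Real.log t)) 0 :=
      (continuous_const.mul (continuous_id.sub Real.continuous_mul_log)).continuousAt
    have e1 : ∀ᶠ t in nhds (0:ℝ), ((d:ℝ) + 1) * (t - t * Real.log t) < -gg d t0 / 2 :=
      hcn.eventually (gt_mem_nhds (by simp; linarith))
    have e2 : ∀ᶠ t in nhds (0:ℝ), t < t0 := gt_mem_nhds ht0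
    have := ((e1.and e2).filter_mono nhdsWithin_le_nhds : ∀ᶠ t in nhdsWithin (0:ℝ) (Set.Ioi 0), _)
    obtain ⟨a, h1, h2⟩ := (this.and self_mem_nhdsWithin).exists
    have h2 : 0 < a := h2
    refine ⟨a, h2, h1.2, lt_of_le_of_lt ?_ h1.1⟩
    unfold Kf
    have : 0 ≤ cf d a * ht d a := by
      have h3 : a < 1 := by linarith [h1.2]
      have h4 : 0 < 1 - a := by linarith
      refine mul_nonneg ?_ ?_
      · unfold cf; exact div_nonneg (by linarith [Real.log_neg h2 h3]) (by positivity)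
      · unfold ht; have := pow_le_one₀ (n := d + 1) h4.le (by linarith); linarith
    linarith
  set Δ := cf d a - cf d t0
  obtain ⟨M, hM⟩ := exists_nat_gt (((d + 1) * (t0 - a) * Δ) / (-gg d t0 / 2))
  have hanti := cf_anti d hd hx0 hx1 hg
  have hΔ : 0 < Δ := by
    have := hanti ⟨ha0, by linarith⟩ ⟨ht0, htx.le⟩ hat
    simp only [Δ]; linarith
  have hMpos : (0:ℝ) < M := lt_of_le_of_lt (div_nonneg (by
    have : 0 < t0 - a := by linarith
    positivity) (by linarith)) hM
  set η := (t0 - a) / M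
  have hη : 0 < η := div_pos (by linarith) hMpos
  set t : ℕ → ℝ := fun i => t0 - i * η
  have htM : t M = a := by simp only [t, η]; field_simp; ring
  have htle : ∀ i ≤ M, a ≤ t i ∧ t i ≤ t0 := by
    intro i hi
    have : (i:ℝ) ≤ M := by exact_mod_cast hi
    constructor
    · rw [← htM]; simp only [t]; nlinarith
    · simp only [t]; nlinarith [(Nat.cast_nonneg i : (0:ℝ) ≤ i)]
  have hst : ∀ i, t i = t (i + 1) + η := by intro i; simp only [t]; push_cast; ring
  have hcm : ∀ i < M, cf d (t i) ≤ cf d (t (i + 1)) := by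
    intro i hi
    have h1 := htle i hi.le
    have h2 := htle (i + 1) hi
    exact hanti.antitoneOn ⟨by linarith, by linarith⟩ ⟨by linarith, by linarith⟩ (by rw [hst i]; linarith)
  refine ⟨M, t, fun i hi => ⟨by linarith [(htle i hi).1], by linarith [(htle i hi).2]⟩, ?_, hcm, ?_⟩
  · simp only [t]; simp; exact ht0c.le
  · have hstep : ∀ i ∈ range M, (Kf d (t i) - Kf d (t (i + 1))) -
        (cf d (t (i + 1)) - cf d (t i)) * ((d + 1) * η) ≤
        (cf d (t (i + 1)) - cf d (t i)) * ht d (t (i + 1)) := by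
      intro i hi
      have hi := Finset.mem_range.mp hi
      have h1 := htle i hi.le
      have h2 := htle (i + 1) hi
      have k1 := Kf_step d hd hx0 hx1 hg (t := t (i + 1)) (s := t i) (by linarith)
        (by rw [hst i]; linarith) (by linarith)
      have k2 : ht d (t i) ≤ ht d (t (i + 1)) + (d + 1) * η := by
        have := pow_lip (d + 1) (a := 1 - t (i + 1)) (b := 1 - t i) (by linarith)
          (by rw [hst i]; linarith) (by linarith)
        unfold ht
        have e := hst i
        push_cast at this
        have e2 : 1 - t (i + 1) - (1 - t i) = η := by linarith
        rw [e2] at this; linarith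
      have k3 := hcm i hi
      nlinarith
    have hsum := Finset.sum_le_sum hstep
    rw [Finset.sum_sub_distrib, ← Finset.sum_mul, Finset.sum_range_sub', Finset.sum_range_sub (fun i => cf d (t i)), htM] at hsum
    have ht00 : t 0 = t0 := by simp [t]
    rw [ht00] at hsum ⊢
    have hsm : (cf d a - cf d t0) * ((d + 1) * η) < -gg d t0 / 2 := by
      rw [div_lt_iff₀ (by linarith)] at hM
      have : (cf d a - cf d t0) * ((d + 1) * η) = ((d + 1) * (t0 - a) * Δ) / M := by
        simp only [Δ, η]; ring
      rw [this, div_lt_iff₀ hMpos]; linarith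
    linarith

def ys (d : ℕ) (c : ℝ) : ℕ → ℝ
  | 0 => 1
  | k + 1 => 1 - Real.exp (-(c * (ys d c k) ^ d))

lemma ys_nonneg (d : ℕ) {c : ℝ} (hc : 0 ≤ c) (k : ℕ) : 0 ≤ ys d c k := by
  induction k with
  | zero => simp [ys]
  | succ k ih =>
    simp only [ys]
    have : Real.exp (-(c * (ys d c k) ^ d)) ≤ 1 := Real.exp_le_one_iff.mpr (by
      have : 0 ≤ c * (ys d c k) ^ d := by positivity
      linarith)
    linarith

lemma ys_anti (d : ℕ) {c : ℝ} (hc : 0 ≤ c) : Antitone (ys d c) := by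
  refine antitone_nat_of_succ_le fun k => ?_
  induction k with
  | zero => simp only [ys]; linarith [Real.exp_pos (-(c * 1 ^ d))]
  | succ k ih =>
    have h := pow_le_pow_left₀ (ys_nonneg d hc (k+1)) ih d
    show 1 - Real.exp (-(c * (ys d c (k+1)) ^ d)) ≤ 1 - Real.exp (-(c * (ys d c k) ^ d))
    have := mul_le_mul_of_nonneg_left h hc
    have := Real.exp_le_exp.mpr (neg_le_neg this)
    linarith

lemma ys_lim (d : ℕ) (hd : 1 ≤ d) {x : ℝ} (hx0 : 0 < x) (hx1 : x < 1) (hg : gg d x = 0) {t : ℝ}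
    (h0 : 0 < t) (htx : t ≤ x) :
    ∃ L, Tendsto (ys d (cf d t)) atTop (nhds L) ∧ ht d t ≤ 1 - L ^ (d + 1) := by
  have h1 : 0 < 1 - t := by linarith
  have hc : 0 ≤ cf d t := by
    unfold cf; exact div_nonneg (by linarith [Real.log_neg h0 (by linarith)]) (by positivity)
  have hT := tendsto_atTop_ciInf (ys_anti d hc) ⟨0, by rintro _ ⟨k, rfl⟩; exact ys_nonneg d hc k⟩
  set L := ⨅ i, ys d (cf d t) i
  have hL0 : 0 ≤ L := ge_of_tendsto' hT (ys_nonneg d hc)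
  have hfix : L = 1 - Real.exp (-(cf d t * L ^ d)) := by
    have a1 : Tendsto (fun k => ys d (cf d t) (k + 1)) atTop (nhds L) :=
      hT.comp (tendsto_add_atTop_nat 1)
    have a2 : Tendsto (fun k => ys d (cf d t) (k + 1)) atTop
        (nhds (1 - Real.exp (-(cf d t * L ^ d)))) := by
      simp only [ys]
      exact ((Real.continuous_exp.tendsto _).comp ((hT.pow d).const_mul _).neg).const_sub 1
    exact tendsto_nhds_unique a1 a2
  have hL : L ≤ 1 - t := by
    by_contra hcon
    push Not at hcon
    set s := 1 - L
    have hs : s = Real.exp (-(cf d t * L ^ d)) := by simp only [s]; linarith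
    have hs0 : 0 < s := by rw [hs]; exact Real.exp_pos _
    have hst : s < t := by simp only [s]; linarith
    have hLpos : 0 < L := by linarith
    have : cf d s = cf d t := by
      have : Real.log s = -(cf d t * L ^ d) := by rw [hs, Real.log_exp]
      have e : 1 - s = L := by simp only [s]; ring
      rw [cf, this, e]; field_simp
    have := cf_anti d hd hx0 hx1 hg ⟨hs0, by linarith⟩ ⟨h0, htx⟩ hst
    linarith
  refine ⟨L, hT, ?_⟩
  unfold ht
  have := pow_le_pow_left₀ hL0 hL (d + 1)
  linarith

lemma analysis_main (d : ℕ) (hd : 1 ≤ d) {x : ℝ} (hx0 : 0 < x) (hx1 : x < 1) (hg : gg d x = 0)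
    {c : ℝ} (hc : cf d x < c) : ∃ (M k : ℕ) (cs : ℕ → ℝ), 0 < cs 0 ∧ cs 0 ≤ c ∧
      (∀ i < M, cs i ≤ cs (i + 1)) ∧
      0 < cs 0 - (d + 1) + ∑ i ∈ range M, (cs (i + 1) - cs i) * (1 - (ys d (cs (i + 1)) k) ^ (d + 1)) := by
  obtain ⟨M, t, h1, h2, h3, h4⟩ := grid d hd hx0 hx1 hg hc
  have hL : ∀ i, ∃ L, i ≤ M → Tendsto (ys d (cf d (t i))) atTop (nhds L) ∧ ht d (t i) ≤ 1 - L ^ (d + 1) := by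
    intro i
    by_cases hi : i ≤ M
    · obtain ⟨L, hL⟩ := ys_lim d hd hx0 hx1 hg (h1 i hi).1 (h1 i hi).2
      exact ⟨L, fun _ => hL⟩
    · exact ⟨0, fun h => absurd h hi⟩
  choose L hL using hL
  have hT : Tendsto (fun k => cf d (t 0) - (d + 1) + ∑ i ∈ range M, (cf d (t (i + 1)) - cf d (t i)) *
      (1 - (ys d (cf d (t (i + 1))) k) ^ (d + 1))) atTop
      (nhds (cf d (t 0) - (d + 1) + ∑ i ∈ range M, (cf d (t (i + 1)) - cf d (t i)) *
      (1 - (L (i + 1)) ^ (d + 1)))) := by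
    refine Tendsto.const_add _ (tendsto_finsetSum _ fun i hi => ?_)
    exact (((hL (i + 1) (Finset.mem_range.mp hi)).1.pow (d + 1)).const_sub 1).const_mul _
  have hpos : 0 < cf d (t 0) - (d + 1) + ∑ i ∈ range M, (cf d (t (i + 1)) - cf d (t i)) *
      (1 - (L (i + 1)) ^ (d + 1)) := by
    refine lt_of_lt_of_le h4 (add_le_add le_rfl (Finset.sum_le_sum fun i hi => ?_))
    have hi := Finset.mem_range.mp hi
    exact mul_le_mul_of_nonneg_left (hL (i + 1) hi).2 (by linarith [h3 i hi])
  obtain ⟨k, hk⟩ := (hT.eventually (lt_mem_nhds hpos)).exists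
  refine ⟨M, k, fun i => cf d (t i), ?_, h2, h3, hk⟩
  have := h1 0 (Nat.zero_le _)
  have h1' : 0 < 1 - t 0 := by linarith
  unfold cf
  exact div_pos (by linarith [Real.log_neg this.1 (by linarith)]) (by positivity)

lemma bs_tendsto (d : ℕ) (C c : ℝ) (k : ℕ) :
    Tendsto (fun n : ℕ => bs d C (c / n) n k) atTop (nhds (ys d c k)) := by
  induction k with
  | zero => simp only [bs, ys]; exact tendsto_const_nhds
  | succ k ih =>
    have hp : Tendsto (fun n : ℕ => c / (n : ℝ)) atTop (nhds 0) := tendsto_const_div_atTop_nhds_zero_nat c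
    set z : ℕ → ℝ := fun n => c / n * ((bs d C (c / n) n k) ^ d + KK d C k * (c / n)) with hz
    have hin : Tendsto (fun n : ℕ => (bs d C (c / n) n k) ^ d + KK d C k * (c / n)) atTop
        (nhds ((ys d c k) ^ d)) := by
      have := (ih.pow d).add (hp.const_mul (KK d C k))
      simpa using this
    have hz0 : Tendsto z atTop (nhds 0) := by
      have := hp.mul hin; simpa using this
    have hnz : Tendsto (fun n : ℕ => (n : ℝ) * z n) atTop (nhds (c * (ys d c k) ^ d)) := by
      refine (hin.const_mul c).congr' ?_
      filter_upwards [eventually_gt_atTop 0] with n hn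
      have : (n : ℝ) ≠ 0 := by exact_mod_cast hn.ne'
      simp only [z]; field_simp
    have hmin : Tendsto (fun n : ℕ => (n : ℝ) * (-(min 1 (z n)))) atTop
        (nhds (-(c * (ys d c k) ^ d))) := by
      refine hnz.neg.congr' ?_
      filter_upwards [hz0.eventually (gt_mem_nhds zero_lt_one)] with n hn
      rw [min_eq_right hn.le]; ring
    have := (Real.tendsto_one_add_pow_exp_of_tendsto hmin).const_sub 1
    simp only [bs, ys]
    refine this.congr fun n => ?_
    rw [← sub_eq_add_neg]

end
end AL

namespace AL
noncomputable section

section expect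
variable {V : Type} [Fintype V] [DecidableEq V] [LinearOrder V]

lemma rk_bd_le (d : ℕ) (Y : Finset (Finset V)) :
    rk (bd d) Y ≤ ((Fintype.card V).choose d : ℝ) := by
  refine (rk_le _ _).trans ?_
  rw [Module.finrank_fintype_fun_eq_card, Fintype.card_finset_len]

lemma exp_lb {C : ℝ} (d : ℕ) (hd : 1 ≤ d) (M k : ℕ) (p : ℕ → ℝ) (h0 : 0 < p 0) (hm : Monotone p)
    (h2 : p M ≤ 1 / 2) (hC : Fintype.card V * p M ≤ C) :
    ((Fintype.card V).choose (d + 1) : ℝ) * (p 0 + ∑ i ∈ range M, (p (i + 1) - p i) *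
      (1 - ((bs d C (p (i + 1)) (Fintype.card V) k) ^ (d + 1) + KK d C k * p (i + 1)))) -
      ((Fintype.card V).choose d : ℝ) ≤
    Ex (p 0) (powersetCard (d + 1) (univ : Finset V)) (nul (bd d)) := by
  set S : Finset (Finset V) := powersetCard (d + 1) univ with hS
  have hcard : (#S : ℝ) = (Fintype.card V).choose (d + 1) := by
    rw [hS, Finset.card_powersetCard, Finset.card_univ]
  have e1 : Ex (p 0) S (nul (bd d)) = #S * p 0 - Ex (p 0) S (rk (bd d)) := by
    rw [← Ex_card, ← Ex_sub]; rfl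
  have hp : ∀ i, 0 < p i := fun i => lt_of_lt_of_le h0 (hm (Nat.zero_le i))
  have st : ∀ i ∈ range M, #S * ((p (i + 1) - p i) *
      (1 - ((bs d C (p (i + 1)) (Fintype.card V) k) ^ (d + 1) + KK d C k * p (i + 1)))) ≤
      Ex (p (i + 1)) S (rk (bd d)) - Ex (p i) S (rk (bd d)) := by
    intro i hi
    have hi := Finset.mem_range.mp hi
    have hle : p (i + 1) ≤ p M := hm hi
    refine le_trans ?_ (Ex_concave (hp i).le (hm (Nat.le_succ i)) (by linarith) S (rk (bd d))
      (rk_diff_anti (bd d)))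
    have : ∑ a ∈ S, (1 - ((bs d C (p (i + 1)) (Fintype.card V) k) ^ (d + 1) + KK d C k * p (i + 1))) ≤
        ∑ a ∈ S, Ex (p (i + 1)) S (fun Y => rk (bd d) (insert a Y) - rk (bd d) (Y.erase a)) := by
      refine Finset.sum_le_sum fun a ha => ?_
      refine diff_lb d hd (hp _) (by linarith) (le_trans ?_ hC) k a (Finset.mem_powersetCard.mp ha).2
      exact mul_le_mul_of_nonneg_left hle (by positivity)
    rw [Finset.sum_const, nsmul_eq_mul] at this
    have := mul_le_mul_of_nonneg_left this (sub_nonneg.mpr (hm (Nat.le_succ i)))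
    simp only [Nat.succ_eq_add_one] at this
    linarith
  have sm := Finset.sum_le_sum st
  rw [Finset.sum_range_sub (fun i => Ex (p i) S (rk (bd d))), ← Finset.mul_sum] at sm
  have top : Ex (p M) S (rk (bd d)) ≤ ((Fintype.card V).choose d : ℝ) := by
    rw [← Ex_const (p M) S ((Fintype.card V).choose d : ℝ)]
    exact Ex_mono (hp M).le (by linarith) S fun Y _ => rk_bd_le d Y
  rw [e1, ← hcard]
  linarith

lemma cheb {p E0 : ℝ} (d : ℕ) (h0 : 0 ≤ p) (h1 : p ≤ 1) (S : Finset (Finset V)) (hE : 0 < E0)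
    (hle : E0 ≤ Ex p S (nul (bd d))) : Pr p S (LI (bd d)) ≤ #S * p / E0 ^ 2 := by
  set m := Ex p S (nul (bd d))
  have hv := var_le h0 h1 S (nul (bd d)) (nul_lip (bd d))
  have e : Ex p S (fun Y => (nul (bd d) Y - m) ^ 2) = Ex p S (fun Y => (nul (bd d) Y) ^ 2) - m ^ 2 := by
    have : ∀ Y ⊆ S, (nul (bd d) Y - m) ^ 2 = (nul (bd d) Y) ^ 2 - 2 * m * nul (bd d) Y + m ^ 2 :=
      fun Y _ => by ring
    rw [Ex_congr S this, Ex_add, Ex_sub, Ex_mul_left, Ex_const]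
    simp only [m]; ring
  have h2 : m ^ 2 * Pr p S (LI (bd d)) ≤ Ex p S (fun Y => (nul (bd d) Y - m) ^ 2) := by
    unfold Pr
    rw [← Ex_mul_left]
    refine Ex_mono h0 h1 S fun Y _ => ?_
    by_cases h : LI (bd d) Y
    · rw [ind_true h, nul_LI _ _ h]; apply le_of_eq; ring
    · rw [ind_false h, mul_zero]; positivity
  have h3 : E0 ^ 2 ≤ m ^ 2 := pow_le_pow_left₀ hE.le hle 2
  have h4 := Pr_nonneg (p := p) S h0 h1 (LI (bd d))
  rw [le_div_iff₀ (by positivity)]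
  nlinarith
end expect

lemma analysis_main' (d : ℕ) (hd : 1 ≤ d) {x : ℝ} (hx0 : 0 < x) (hx1 : x < 1) (hg : gg d x = 0)
    {c : ℝ} (hc : cf d x < c) : ∃ (M k : ℕ) (cs : ℕ → ℝ), 0 < cs 0 ∧ cs 0 ≤ c ∧ Monotone cs ∧
      0 < cs 0 - (d + 1) + ∑ i ∈ range M, (cs (i + 1) - cs i) * (1 - (ys d (cs (i + 1)) k) ^ (d + 1)) := by
  obtain ⟨M, k, cs, h1, h2, h3, h4⟩ := analysis_main d hd hx0 hx1 hg hc
  refine ⟨M, k, fun i => cs (min i M), by simpa using h1, by simpa using h2, ?_, ?_⟩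
  · refine monotone_nat_of_le_succ fun i => ?_
    rcases lt_or_ge i M with h | h
    · rw [min_eq_left h.le, min_eq_left h]; exact h3 i h
    · rw [min_eq_right h, min_eq_right (by omega)]
  · have e : ∀ i ∈ range M, (cs (min (i + 1) M) - cs (min i M)) *
        (1 - (ys d (cs (min (i + 1) M)) k) ^ (d + 1)) =
        (cs (i + 1) - cs i) * (1 - (ys d (cs (i + 1)) k) ^ (d + 1)) := by
      intro i hi
      have hi := Finset.mem_range.mp hi
      rw [min_eq_left hi.le, min_eq_left hi]
    simp only [Nat.zero_min]
    rw [Finset.sum_congr rfl e]; exact h4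

lemma choose_tendsto (d : ℕ) (hd : 1 ≤ d) :
    Tendsto (fun n : ℕ => (n.choose d : ℝ)) atTop atTop := by
  have h1 : Tendsto (fun n : ℕ => ((n : ℝ) - d) / (d.factorial : ℝ)) atTop atTop :=
    (tendsto_atTop_add_const_right _ (-(d:ℝ)) tendsto_natCast_atTop_atTop).atTop_div_const
      (by positivity)
  refine tendsto_atTop_mono' _ ?_ h1
  filter_upwards [eventually_ge_atTop d] with n hn
  have := Nat.pow_le_choose (α := ℝ) d n
  rw [div_le_iff₀ (by positivity)]
  have h2 : ((n + 1 - d : ℕ) : ℝ) = n + 1 - d := by rw [Nat.cast_sub (by omega)]; push_cast; ring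
  have hn' : (d : ℝ) ≤ n := by exact_mod_cast hn
  have h3 : ((n + 1 - d : ℕ) : ℝ) ≤ ((n + 1 - d : ℕ) : ℝ) ^ d :=
    le_self_pow₀ (by rw [h2]; linarith) (by omega)
  rw [div_le_iff₀ (by positivity)] at this
  linarith

lemma pr_tendsto (d : ℕ) (hd : 1 ≤ d) {x : ℝ} (hx0 : 0 < x) (hx1 : x < 1) (hg : gg d x = 0)
    {c : ℝ} (hc : cf d x < c) : ∃ c0, 0 < c0 ∧ c0 ≤ c ∧
    Tendsto (fun n : ℕ => Pr (c0 / n) (powersetCard (d + 1) (univ : Finset (Fin n))) (LI (bd d)))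
      atTop (nhds 0) := by
  obtain ⟨M, k, cs, h1, h2, h3, h4⟩ := analysis_main' d hd hx0 hx1 hg hc
  refine ⟨cs 0, h1, h2, ?_⟩
  set C := cs M
  have hdiv : ∀ r : ℝ, Tendsto (fun n : ℕ => r / (n : ℝ)) atTop (nhds 0) :=
    fun r => tendsto_const_div_atTop_nhds_zero_nat r
  set Q : ℕ → ℝ := fun n => cs 0 + ∑ i ∈ range M, (cs (i + 1) - cs i) *
      (1 - ((bs d C (cs (i + 1) / n) n k) ^ (d + 1) + KK d C k * (cs (i + 1) / n)))
  set R : ℕ → ℝ := fun n => (1 - d / n) / (d + 1) * Q n - 1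
  have hQ : Tendsto Q atTop (nhds (cs 0 + ∑ i ∈ range M, (cs (i + 1) - cs i) *
      (1 - (ys d (cs (i + 1)) k) ^ (d + 1)))) := by
    refine Tendsto.const_add _ (tendsto_finsetSum _ fun i _ => ?_)
    have := (((bs_tendsto d C (cs (i + 1)) k).pow (d + 1)).add
      ((hdiv (cs (i + 1))).const_mul (KK d C k))).const_sub 1
    simp only [mul_zero, add_zero] at this
    exact this.const_mul _
  set Q0 := cs 0 + ∑ i ∈ range M, (cs (i + 1) - cs i) * (1 - (ys d (cs (i + 1)) k) ^ (d + 1))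
  have hR : Tendsto R atTop (nhds (1 / (d + 1) * Q0 - 1)) := by
    have := ((((hdiv (d:ℝ)).const_sub 1).div_const ((d:ℝ) + 1)).mul hQ).sub_const 1
    simpa using this
  set δ := (1 / (d + 1) * Q0 - 1) / 2
  have hδ : 0 < δ := by
    have : (0:ℝ) < d + 1 := by positivity
    have h5 : (d + 1 : ℝ) < Q0 := by simp only [Q0]; linarith
    have : 1 < 1 / (d + 1) * Q0 := by rw [one_div, inv_mul_eq_div, one_lt_div this]; exact h5
    simp only [δ]; linarith
  have ev1 : ∀ᶠ n in atTop, δ < R n := hR.eventually (lt_mem_nhds (by simp only [δ] at hδ ⊢; linarith))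
  have ev2 : ∀ᶠ n : ℕ in atTop, C / n < 1 / 2 := (hdiv C).eventually (gt_mem_nhds (by norm_num))
  have hup : Tendsto (fun n : ℕ => cs 0 / δ ^ 2 / (n.choose d : ℝ)) atTop (nhds 0) :=
    (choose_tendsto d hd).const_div_atTop _
  have hC0 : cs 0 ≤ C := h3 (Nat.zero_le M)
  refine tendsto_of_tendsto_of_tendsto_of_le_of_le' tendsto_const_nhds hup ?_ ?_
  · filter_upwards [ev2, eventually_gt_atTop 0] with n hn hn0
    have : (0:ℝ) < n := by exact_mod_cast hn0
    have : cs 0 / n ≤ C / n := by gcongr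
    exact Pr_nonneg _ (by positivity) (by linarith) _
  · filter_upwards [ev1, ev2, eventually_gt_atTop d] with n hR hn hnd
    have hn0 : (0:ℝ) < n := by exact_mod_cast (by omega : 0 < n)
    have hle : cs 0 / n ≤ C / n := by gcongr
    have hch : (0:ℝ) < n.choose d := by exact_mod_cast Nat.choose_pos hnd.le
    have hN : (n.choose (d + 1) : ℝ) = n.choose d * (n - d) / (d + 1) := by
      have := Nat.choose_succ_right_eq n d
      have : (n.choose (d + 1) : ℝ) * (d + 1) = n.choose d * (n - d) := by
        rw [← Nat.cast_sub hnd.le]; exact_mod_cast this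
      rw [← this]; field_simp
    have lb := exp_lb (V := Fin n) (C := C) d hd M k (fun i => cs i / n) (by positivity)
      (fun i j hij => by have := h3 hij; simp only; gcongr) hn.le
      (by rw [Fintype.card_fin]; apply le_of_eq; field_simp; rfl)
    simp only [Fintype.card_fin] at lb
    have e1 : (n.choose (d + 1) : ℝ) * (cs 0 / n + ∑ i ∈ range M, (cs (i + 1) / n - cs i / n) *
      (1 - ((bs d C (cs (i + 1) / n) n k) ^ (d + 1) + KK d C k * (cs (i + 1) / n)))) -
      (n.choose d : ℝ) = n.choose d * R n := by
      have : cs 0 / n + ∑ i ∈ range M, (cs (i + 1) / n - cs i / n) *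
        (1 - ((bs d C (cs (i + 1) / n) n k) ^ (d + 1) + KK d C k * (cs (i + 1) / n))) = Q n / n := by
        simp only [Q]
        rw [add_div, Finset.sum_div]
        congr 1
        refine Finset.sum_congr rfl fun i _ => ?_
        ring
      rw [this, hN]
      simp only [R]
      field_simp
    rw [e1] at lb
    have lb2 : n.choose d * δ ≤ Ex (cs 0 / n) (powersetCard (d + 1) (univ : Finset (Fin n))) (nul (bd d)) :=
      le_trans (mul_le_mul_of_nonneg_left hR.le hch.le) lb
    have := cheb d (p := cs 0 / n) (by positivity) (by linarith) _ (mul_pos hch hδ) lb2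
    refine this.trans ?_
    rw [Finset.card_powersetCard, Finset.card_univ, Fintype.card_fin, hN]
    rw [div_div, div_le_div_iff₀ (by positivity) (by positivity)]
    have k1 : (n.choose d : ℝ) * (n - d) / (d + 1) * (cs 0 / n) ≤ n.choose d * cs 0 := by
      have a1 : ((n:ℝ) - d) / (d + 1) / n ≤ 1 := by
        rw [div_div, div_le_one (by positivity)]
        nlinarith [(Nat.cast_nonneg d : (0:ℝ) ≤ d), mul_nonneg (Nat.cast_nonneg d : (0:ℝ) ≤ d) hn0.le]
      have a2 : (n.choose d : ℝ) * (n - d) / (d + 1) * (cs 0 / n) =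
        (n.choose d * cs 0) * (((n:ℝ) - d) / (d + 1) / n) := by ring
      rw [a2]; exact mul_le_of_le_one_right (by positivity) a1
    calc _ ≤ n.choose d * cs 0 * (δ ^ 2 * n.choose d) := by
          refine mul_le_mul_of_nonneg_right k1 (by positivity)
      _ = _ := by ring

/-! measure bridge -/

def clampq (p : ℝ) : ℝ := max 0 (min p 1)

lemma clampq_nonneg (p : ℝ) : 0 ≤ clampq p := le_max_left _ _
lemma clampq_le_one (p : ℝ) : clampq p ≤ 1 := max_le zero_le_one (min_le_right _ _)

lemma bern_singleton (p : ℝ) (b : Bool) :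
    bernoulliBool p {b} = ENNReal.ofReal (if b = true then clampq p else 1 - clampq p) := by
  cases b <;> simp [bernoulliBool, clampq]

def faces (n d : ℕ) (ω : FaceIdx n d → Bool) : Finset (Finset (Fin n)) :=
  (univ.filter (fun i => ω i = true)).map (Function.Embedding.subtype _)

lemma Y_singleton (n d : ℕ) (p : ℝ) (ω : FaceIdx n d → Bool) :
    YMeasure n d p {ω} = ENNReal.ofReal ((clampq p) ^ #(univ.filter (fun i => ω i = true)) *
      (1 - clampq p) ^ #(univ \ univ.filter (fun i => ω i = true))) := by
  unfold YMeasure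
  rw [Measure.pi_singleton]
  simp only [bern_singleton]
  have h1 := clampq_le_one p
  rw [← ENNReal.ofReal_prod_of_nonneg]
  · rw [Finset.prod_ite, Finset.prod_const, Finset.prod_const, Finset.filter_not]
  · intro i _
    split
    · exact clampq_nonneg p
    · linarith

lemma Y_event (n d : ℕ) (p : ℝ) (A : Finset (Finset (Fin n)) → Prop) :
    YMeasure n d p {ω | A (faces n d ω)} =
      ENNReal.ofReal (Pr (clampq p) (powersetCard (d + 1) (univ : Finset (Fin n))) A) := by
  classical
  have h0 := clampq_nonneg p
  have h1 := clampq_le_one p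
  have h1' : 0 ≤ 1 - clampq p := by linarith
  have hS : powersetCard (d + 1) (univ : Finset (Fin n)) =
      (univ : Finset (FaceIdx n d)).map (Function.Embedding.subtype _) := by
    ext s; simp [Finset.mem_powersetCard]
  have e : {ω | A (faces n d ω)} = ((univ.filter fun ω => A (faces n d ω) : Finset (FaceIdx n d → Bool)) :
      Set (FaceIdx n d → Bool)) := by ext; simp
  rw [e, ← sum_measure_singleton]
  unfold Pr
  rw [hS, Ex_map]
  unfold Ex
  simp only [Y_singleton]
  rw [← ENNReal.ofReal_sum_of_nonneg (fun ω _ => by positivity)]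
  congr 1
  rw [Finset.sum_filter]
  refine Finset.sum_nbij' (fun ω => univ.filter (fun i => ω i = true)) (fun Z i => decide (i ∈ Z))
    ?_ ?_ ?_ ?_ ?_
  · intro ω _; simp
  · intro Z _; simp
  · intro ω _; funext i; simp
  · intro Z _; ext i; simp
  · intro ω _
    by_cases h : A (faces n d ω)
    · have h' : A (Finset.map (Function.Embedding.subtype fun s => #s = d + 1)
          (univ.filter (fun i : FaceIdx n d => ω i = true))) := h
      rw [if_pos h]
      refine (mul_one _).symm.trans ?_
      congr 1
      exact (ind_true h').symm
    · have h' : ¬ A (Finset.map (Function.Embedding.subtype fun s => #s = d + 1)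
          (univ.filter (fun i : FaceIdx n d => ω i = true))) := h
      rw [if_neg h]
      exact (mul_eq_zero_of_right _ (ind_false h')).symm

instance (p : ℝ) : IsProbabilityMeasure (bernoulliBool p) := by
  constructor
  have h0 := clampq_nonneg p
  have h1 := clampq_le_one p
  simp only [bernoulliBool, Measure.add_apply, Measure.smul_apply, smul_eq_mul,
    measure_univ, mul_one]
  rw [← ENNReal.ofReal_add (le_max_left _ _) (by unfold clampq at h1; linarith)]
  simp

instance (n d : ℕ) (p : ℝ) : IsProbabilityMeasure (YMeasure n d p) := by
  unfold YMeasure; infer_instance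

lemma top_le (n d : ℕ) (p : ℝ) : YMeasure n d p {ω | TopHomologyZero (Ycomplex n d ω) d ℝ} ≤
    ENNReal.ofReal (Pr (clampq p) (powersetCard (d + 1) (univ : Finset (Fin n))) (LI (bd d))) := by
  rw [← Y_event]
  refine measure_mono ?_
  intro ω hω
  refine LI_of_top d (Ycomplex n d ω) (faces n d ω) ?_ hω
  intro σ
  simp only [faces, Finset.mem_map, Finset.mem_filter, Finset.mem_univ, true_and, Ycomplex,
    Function.Embedding.subtype_apply]
  constructor
  · rintro ⟨a, ha, rfl⟩
    exact ⟨Or.inr ⟨a.2, ha⟩, a.2⟩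
  · rintro ⟨h | ⟨h, h'⟩, hc⟩
    · omega
    · exact ⟨⟨σ, h⟩, h', rfl⟩

theorem main (d : ℕ) (hd : 2 ≤ d)
    (x : ℝ) (hx : x ∈ Set.Ioo (0 : ℝ) 1)
    (hroot : ((d : ℝ) + 1) * (1 - x) + (1 + (d : ℝ) * x) * Real.log x = 0)
    (c : ℝ) (hc : (-Real.log x) / (1 - x) ^ d < c)
    (p : ℕ → ℝ) (hp : ∀ n : ℕ, c / n ≤ p n) :
    Tendsto (fun n : ℕ => YMeasure n d (p n)
        {ω | ¬ TopHomologyZero (Ycomplex n d ω) d ℝ})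
      atTop (nhds (1 : ENNReal)) := by
  obtain ⟨c0, h0, hc0, hT⟩ := pr_tendsto d (by omega) hx.1 hx.2 hroot hc
  have hT' : Tendsto (fun n : ℕ => 1 - ENNReal.ofReal (Pr (c0 / n)
      (powersetCard (d + 1) (univ : Finset (Fin n))) (LI (bd d)))) atTop (nhds 1) := by
    have := ENNReal.Tendsto.sub (tendsto_const_nhds (x := (1:ENNReal)))
      (ENNReal.tendsto_ofReal hT) (Or.inl ENNReal.one_ne_top)
    simpa using this
  refine tendsto_of_tendsto_of_tendsto_of_le_of_le' hT' tendsto_const_nhds ?_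
    (Eventually.of_forall fun n => prob_le_one)
  have ev : ∀ᶠ n : ℕ in atTop, c0 / (n:ℝ) < 1 :=
    (tendsto_const_div_atTop_nhds_zero_nat c0).eventually (gt_mem_nhds zero_lt_one)
  filter_upwards [ev, eventually_gt_atTop 0] with n hn hn0
  have hn0' : (0:ℝ) < n := by exact_mod_cast hn0
  have hmeas : MeasurableSet {ω | TopHomologyZero (Ycomplex n d ω) d ℝ} :=
    (Set.toFinite _).measurableSet
  have e : {ω | ¬ TopHomologyZero (Ycomplex n d ω) d ℝ} =
      {ω | TopHomologyZero (Ycomplex n d ω) d ℝ}ᶜ := rfl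
  rw [e, prob_compl_eq_one_sub hmeas]
  refine tsub_le_tsub_left ((top_le n d (p n)).trans (ENNReal.ofReal_le_ofReal ?_)) 1
  refine Ex_anti_p (by positivity) ?_ (clampq_le_one _) _ _ ?_
  · refine le_max_of_le_right (le_min ?_ hn.le)
    refine le_trans ?_ (hp n)
    gcongr
  · intro X Y h
    exact ind_mono (LI_anti _ h)

end
end AL


noncomputable section
/-- **The sharp constant for the birth of top homology** (Aronshtam–Linial).
Fix `d ≥ 2`, let `x ∈ (0,1)` be the root of `(d+1)(1−x) + (1+dx)log x = 0` and
`c_d* = −log x/(1−x)^d`. If `p ≥ c/n` with `c > c_d*` constant, then w.h.p.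
`H_d(Y_d(n,p), ℝ) ≠ 0`. -/
theorem aronshtam_linial (d : ℕ) (hd : 2 ≤ d)
    (x : ℝ) (hx : x ∈ Set.Ioo (0 : ℝ) 1)
    (hroot : ((d : ℝ) + 1) * (1 - x) + (1 + (d : ℝ) * x) * Real.log x = 0)
    (c : ℝ) (hc : (-Real.log x) / (1 - x) ^ d < c)
    (p : ℕ → ℝ) (hp : ∀ n : ℕ, c / n ≤ p n) :
    Tendsto (fun n : ℕ => YMeasure n d (p n)
        {ω | ¬ TopHomologyZero (Ycomplex n d ω) d ℝ})
      atTop (nhds (1 : ENNReal)) := by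
  exact AL.main d hd x hx hroot c hc p hp
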